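/- arXiv:2402.07043 — 3 statements merged into one kernel-verified Lean document; each statement's English description precedes it below -/
import Mathlib

section
/- Let β > 1 and β' ∈ (1, β), and set c := (β − 1)/β'. Let p be the Zipf distribution with exponent β (p_i = i^{-β}/ζ(β)) and q be the Zipf distribution with exponent β' (q_i = i^{-β'}/ζ(β')). Then there exist constants C₁, C₂ > 0 and T₀ ≥ 1, depending only on β and β', such that for all integers T ≥ T₀: C₁·T^{-c} ≤ Σ_{i=1}^∞ p_i (1 − q_i)^T ≤ C₂·T^{-c}. That is, a Hutter model trained on T samples from the tail-narrowed distribution q and tested against p has test error of order T^{-(β-1)/β'}. -/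
/-- The Zipf distribution with exponent `β` on the positive integers:
`p i = i^(-β) / ζ(β)`, with `ζ(β) = ∑_{j ≥ 1} j^(-β)`.  (`zipf β 0 = 0`.) -/
noncomputable def zipf (β : ℝ) (i : ℕ) : ℝ :=
  (i : ℝ) ^ (-β) / ∑' j : ℕ, ((j : ℝ) + 1) ^ (-β)

lemma zeta_summable (b : ℝ) (hb : 1 < b) : Summable (fun j : ℕ => ((j : ℝ) + 1) ^ (-b)) := by
  have h : Summable (fun n : ℕ => (n : ℝ) ^ (-b)) := Real.summable_nat_rpow.2 (by linarith)
  simpa using (summable_nat_add_iff 1).2 h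

lemma zeta_ge_one (b : ℝ) (hb : 1 < b) : 1 ≤ ∑' j : ℕ, ((j : ℝ) + 1) ^ (-b) := by
  have := (zeta_summable b hb).le_tsum 0 (fun j _ => by positivity)
  simpa using this

lemma zipf_nonneg (b : ℝ) (i : ℕ) : 0 ≤ zipf b i := by
  unfold zipf
  exact div_nonneg (by positivity) (tsum_nonneg fun j => by positivity)

lemma zipf_le (b : ℝ) (hb : 1 < b) (i : ℕ) : zipf b i ≤ (i : ℝ) ^ (-b) := by
  unfold zipf
  exact div_le_self (by positivity) (zeta_ge_one b hb)

lemma zipf_zero (b : ℝ) (hb : 1 < b) : zipf b 0 = 0 := by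
  unfold zipf
  rw [Nat.cast_zero, Real.zero_rpow (by linarith), zero_div]

lemma zipf_le_one (b : ℝ) (hb : 1 < b) (i : ℕ) : zipf b i ≤ 1 := by
  rcases Nat.eq_zero_or_pos i with rfl | hi
  · rw [zipf_zero b hb]; norm_num
  · refine (zipf_le b hb i).trans (Real.rpow_le_one_of_one_le_of_nonpos ?_ (by linarith))
    exact_mod_cast hi

lemma exp_rpow_bound (m y : ℝ) (hm : 0 < m) (hy : 0 ≤ y) : Real.exp (-y) * y ^ m ≤ m ^ m := by
  have h1 : y / m ≤ Real.exp (y / m) := by linarith [Real.add_one_le_exp (y / m)]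
  have h2 : (y / m) ^ m ≤ Real.exp y := by
    calc (y / m) ^ m ≤ (Real.exp (y / m)) ^ m := Real.rpow_le_rpow (by positivity) h1 hm.le
      _ = Real.exp y := by rw [← Real.exp_mul]; congr 1; field_simp
  rw [Real.div_rpow hy hm.le, div_le_iff₀ (by positivity)] at h2
  rw [Real.exp_neg, inv_mul_le_iff₀ (Real.exp_pos y)]
  exact h2

lemma term_nonneg (b b' : ℝ) (hb' : 1 < b') (T i : ℕ) :
    0 ≤ zipf b i * (1 - zipf b' i) ^ T :=
  mul_nonneg (zipf_nonneg b i) (pow_nonneg (by linarith [zipf_le_one b' hb' i]) _)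

lemma term_le (b b' : ℝ) (hb : 1 < b) (hb' : 1 < b') (T i : ℕ) :
    zipf b i * (1 - zipf b' i) ^ T ≤ (i : ℝ) ^ (-b) := by
  refine le_trans (mul_le_of_le_one_right (zipf_nonneg b i) ?_) (zipf_le b hb i)
  exact pow_le_one₀ (by linarith [zipf_le_one b' hb' i]) (by linarith [zipf_nonneg b' i])

lemma term_summable (b b' : ℝ) (hb : 1 < b) (hb' : 1 < b') (T : ℕ) :
    Summable (fun i : ℕ => zipf b i * (1 - zipf b' i) ^ T) :=
  Summable.of_nonneg_of_le (fun i => term_nonneg b b' hb' T i)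
    (fun i => term_le b b' hb hb' T i) (Real.summable_nat_rpow.2 (by linarith))

lemma head_term (b b' x : ℝ) (hb : 1 < b) (hb' : 1 < b') (T : ℕ) (hx : 0 < x)
    (hxT : x ^ b' = T) (i : ℕ) :
    zipf b i * (1 - zipf b' i) ^ T ≤
      (b / b') ^ (b / b') * (∑' j : ℕ, ((j : ℝ) + 1) ^ (-b')) ^ (b / b') * x ^ (-b) := by
  have hZ := zeta_ge_one b' hb'
  set Z := ∑' j : ℕ, ((j : ℝ) + 1) ^ (-b') with hZd
  have hm : 0 < b / b' := by positivity
  set m := b / b' with hmd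
  have hZ0 : 0 < Z := by linarith
  rcases Nat.eq_zero_or_pos i with rfl | hi
  · rw [zipf_zero b hb, zero_mul]; positivity
  have hi0 : (0 : ℝ) < i := by exact_mod_cast hi
  have hq : zipf b' i = (i : ℝ) ^ (-b') / Z := rfl
  set y := (T : ℝ) * zipf b' i with hy
  have hy0 : 0 ≤ y := mul_nonneg (by positivity) (zipf_nonneg _ _)
  have hpow : (1 - zipf b' i) ^ T ≤ Real.exp (-y) := by
    calc (1 - zipf b' i) ^ T ≤ (Real.exp (-zipf b' i)) ^ T :=
          pow_le_pow_left₀ (by linarith [zipf_le_one b' hb' i]) (Real.one_sub_le_exp_neg _) _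
      _ = Real.exp (-y) := by rw [← Real.exp_nat_mul, hy]; congr 1; ring
  have hym : y ^ m = x ^ b * (i : ℝ) ^ (-b) / Z ^ m := by
    rw [hy, hq, ← hxT, ← mul_div_assoc, Real.div_rpow (by positivity) hZ0.le,
      Real.mul_rpow (by positivity) (by positivity), ← Real.rpow_mul hx.le, ← Real.rpow_mul hi0.le]
    have e : b' * m = b := by rw [hmd]; field_simp
    rw [e, neg_mul, e]
  have hE := exp_rpow_bound m y hm hy0
  rw [hym] at hE
  calc zipf b i * (1 - zipf b' i) ^ T ≤ (i : ℝ) ^ (-b) * Real.exp (-y) :=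
        mul_le_mul (zipf_le b hb i) hpow (pow_nonneg (by linarith [zipf_le_one b' hb' i]) _)
          (by positivity)
    _ = (Real.exp (-y) * (x ^ b * (i : ℝ) ^ (-b) / Z ^ m)) * Z ^ m * x ^ (-b) := by
        rw [Real.rpow_neg hx.le]
        have : x ^ b ≠ 0 := by positivity
        have : Z ^ m ≠ 0 := by positivity
        field_simp
    _ ≤ m ^ m * Z ^ m * x ^ (-b) := by gcongr

lemma tail_bound (b : ℝ) (hb : 1 < b) (N : ℕ) (hN : 0 < N) :
    ∑' n : ℕ, ((n + (N + 1) : ℕ) : ℝ) ^ (-b) ≤ (N : ℝ) ^ (1 - b) / (b - 1) := by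
  have hN0 : (0 : ℝ) < N := by exact_mod_cast hN
  have h := AntitoneOn.tsum_comp_add_le_integral (f := fun t : ℝ => t ^ (-b)) N
    ((Real.antitoneOn_rpow_Ioi_of_exponent_nonpos (by linarith)).mono
      (fun t ht => lt_of_lt_of_le hN0 ht))
    (integrableOn_Ioi_rpow_of_lt (by linarith) hN0)
    (fun t ht => Real.rpow_nonneg (hN0.le.trans (le_of_lt ht)) _)
  rw [integral_Ioi_rpow_of_lt (by linarith) hN0] at h
  refine h.trans_eq ?_
  have e : -b + 1 = -(b - 1) := by ring
  rw [show 1 - b = -(b - 1) by ring, e, neg_div_neg_eq]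

lemma upper_bound (b b' x : ℝ) (hb : 1 < b) (hb' : 1 < b') (T N : ℕ) (hx : 1 ≤ x)
    (hxT : x ^ b' = T) (hN1 : x ≤ N) (hN2 : (N : ℝ) ≤ 2 * x) :
    (∑' i : ℕ, zipf b i * (1 - zipf b' i) ^ T) ≤
      (3 * ((b / b') ^ (b / b') * (∑' j : ℕ, ((j : ℝ) + 1) ^ (-b')) ^ (b / b')) + 1 / (b - 1))
        * x ^ (1 - b) := by
  have hx0 : 0 < x := by linarith
  have hN0 : (0 : ℝ) < N := by linarith
  set K := (b / b') ^ (b / b') * (∑' j : ℕ, ((j : ℝ) + 1) ^ (-b')) ^ (b / b') with hK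
  have hK0 : 0 ≤ K := by
    have := zeta_ge_one b' hb'
    have : 0 ≤ ∑' j : ℕ, ((j : ℝ) + 1) ^ (-b') := by linarith
    positivity
  have hs := term_summable b b' hb hb' T
  rw [← hs.sum_add_tsum_nat_add (N + 1)]
  have h1 : ∑ i ∈ Finset.range (N + 1), zipf b i * (1 - zipf b' i) ^ T
      ≤ 3 * K * x ^ (1 - b) := by
    calc _ ≤ ∑ i ∈ Finset.range (N + 1), K * x ^ (-b) :=
          Finset.sum_le_sum fun i _ => head_term b b' x hb hb' T hx0 hxT i
      _ = ((N : ℝ) + 1) * (K * x ^ (-b)) := by simp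
      _ ≤ (3 * x) * (K * x ^ (-b)) := by
          apply mul_le_mul_of_nonneg_right (by linarith) (by positivity)
      _ = 3 * K * x ^ (1 - b) := by
          rw [sub_eq_add_neg, Real.rpow_add hx0, Real.rpow_one]; ring
  have hs1 : Summable (fun i : ℕ => zipf b (i + (N + 1)) * (1 - zipf b' (i + (N + 1))) ^ T) :=
    (summable_nat_add_iff (f := fun i : ℕ => zipf b i * (1 - zipf b' i) ^ T) (N + 1)).2 hs
  have hs2 : Summable (fun n : ℕ => ((n + (N + 1) : ℕ) : ℝ) ^ (-b)) :=
    (summable_nat_add_iff (f := fun n : ℕ => (n : ℝ) ^ (-b)) (N + 1)).2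
      (Real.summable_nat_rpow.2 (by linarith))
  have h2 : ∑' i : ℕ, zipf b (i + (N + 1)) * (1 - zipf b' (i + (N + 1))) ^ T
      ≤ 1 / (b - 1) * x ^ (1 - b) := by
    calc _ ≤ ∑' n : ℕ, ((n + (N + 1) : ℕ) : ℝ) ^ (-b) :=
          Summable.tsum_le_tsum (fun i => term_le b b' hb hb' T _)
            hs1 hs2
      _ ≤ (N : ℝ) ^ (1 - b) / (b - 1) := tail_bound b hb N (by exact_mod_cast hN0)
      _ ≤ x ^ (1 - b) / (b - 1) :=
          div_le_div_of_nonneg_right (Real.rpow_le_rpow_of_nonpos hx0 hN1 (by linarith))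
            (by linarith)
      _ = _ := by ring
  linarith

lemma lower_bound (b b' x : ℝ) (hb : 1 < b) (hb' : 1 < b') (T N : ℕ) (hx : 1 ≤ x)
    (hxT : x ^ b' = T) (hN1 : x ≤ N) (hN2 : (N : ℝ) ≤ 2 * x) :
    (8 : ℝ) ^ (-b) / (∑' j : ℕ, ((j : ℝ) + 1) ^ (-b)) * x ^ (1 - b) ≤
    (∑' i : ℕ, zipf b i * (1 - zipf b' i) ^ T) := by
  have hx0 : 0 < x := by linarith
  have hN0 : (0 : ℝ) < N := by linarith
  have hZ := zeta_ge_one b hb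
  refine le_trans ?_ ((term_summable b b' hb hb' T).sum_le_tsum (Finset.Ico (2 * N) (4 * N))
    (fun i _ => term_nonneg b b' hb' T i))
  have hterm : ∀ i ∈ Finset.Ico (2 * N) (4 * N),
      (8 * x) ^ (-b) / (∑' j : ℕ, ((j : ℝ) + 1) ^ (-b)) * (1 / 2) ≤
        zipf b i * (1 - zipf b' i) ^ T := by
    intro i hi
    rw [Finset.mem_Ico] at hi
    have hi1 : 2 * (N : ℝ) ≤ i := by exact_mod_cast hi.1
    have hi2 : (i : ℝ) ≤ 4 * N := by exact_mod_cast hi.2.le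
    have hi0 : (0 : ℝ) < i := by linarith
    refine mul_le_mul ?_ ?_ (by norm_num) (zipf_nonneg b i)
    · unfold zipf
      exact div_le_div_of_nonneg_right
        (Real.rpow_le_rpow_of_nonpos hi0 (by linarith) (by linarith)) (by linarith)
    · have hB := one_add_mul_le_pow (a := -zipf b' i) (by linarith [zipf_le_one b' hb' i]) T
      have hq : (T : ℝ) * zipf b' i ≤ 1 / 2 := by
        calc (T : ℝ) * zipf b' i ≤ T * (2 * x) ^ (-b') := by
              refine mul_le_mul_of_nonneg_left ((zipf_le b' hb' i).trans ?_) (by positivity)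
              exact Real.rpow_le_rpow_of_nonpos (by positivity) (by linarith) (by linarith)
          _ = 2 ^ (-b') := by
              rw [← hxT, Real.mul_rpow (by norm_num) hx0.le, Real.rpow_neg hx0.le]
              have : x ^ b' ≠ 0 := by positivity
              field_simp
          _ ≤ 2 ^ (-1 : ℝ) := Real.rpow_le_rpow_of_exponent_le (by norm_num) (by linarith)
          _ = 1 / 2 := by rw [Real.rpow_neg_one]; norm_num
      rw [← sub_eq_add_neg] at hB
      linarith
  have hsum := Finset.card_nsmul_le_sum _ _ _ hterm
  refine le_trans ?_ hsum
  rw [Nat.card_Ico, nsmul_eq_mul, show 4 * N - 2 * N = 2 * N by omega,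
    Real.mul_rpow (by norm_num) hx0.le, sub_eq_add_neg, Real.rpow_add hx0, Real.rpow_one]
  push_cast
  have hA : 0 ≤ (8 : ℝ) ^ (-b) / (∑' j : ℕ, ((j : ℝ) + 1) ^ (-b)) * x ^ (-b) :=
    mul_nonneg (div_nonneg (by positivity) (by linarith)) (by positivity)
  calc _ = x * ((8 : ℝ) ^ (-b) / (∑' j : ℕ, ((j : ℝ) + 1) ^ (-b)) * x ^ (-b)) := by ring
    _ ≤ N * ((8 : ℝ) ^ (-b) / (∑' j : ℕ, ((j : ℝ) + 1) ^ (-b)) * x ^ (-b)) :=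
        mul_le_mul_of_nonneg_right hN1 hA
    _ = _ := by ring

/-- For `β > 1` and `β' ∈ (1, β)` and `c = (β-1)/β'`, the Hutter model
trained on `T` samples from the tail-narrowed Zipf distribution `q = Zipf(β')` and
tested against `p = Zipf(β)` has test error `∑_i p_i (1-q_i)^T ≍ T^(-c)`. -/
theorem tail_narrowing_scaling (β β' : ℝ) (hβ : 1 < β) (hβ'1 : 1 < β') (hβ' : β' < β)
    (c : ℝ) (hc : c = (β - 1) / β') :
    ∃ C₁ C₂ : ℝ, 0 < C₁ ∧ 0 < C₂ ∧ ∃ T₀ : ℕ, 1 ≤ T₀ ∧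
      ∀ T : ℕ, T₀ ≤ T →
        C₁ * (T : ℝ) ^ (-c) ≤ (∑' i : ℕ, zipf β i * (1 - zipf β' i) ^ T) ∧
        (∑' i : ℕ, zipf β i * (1 - zipf β' i) ^ T) ≤ C₂ * (T : ℝ) ^ (-c) := by

  have hZ := zeta_ge_one β hβ
  have hZ' := zeta_ge_one β' hβ'1
  refine ⟨(8 : ℝ) ^ (-β) / (∑' j : ℕ, ((j : ℝ) + 1) ^ (-β)),
    3 * ((β / β') ^ (β / β') * (∑' j : ℕ, ((j : ℝ) + 1) ^ (-β')) ^ (β / β')) + 1 / (β - 1),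
    div_pos (by positivity) (by linarith), ?_, 1, le_rfl, ?_⟩
  · have h1 : 0 < ∑' j : ℕ, ((j : ℝ) + 1) ^ (-β') := by linarith
    have h2 : 0 < β - 1 := by linarith
    positivity
  intro T hT
  have hT1 : (1 : ℝ) ≤ T := by exact_mod_cast hT
  have hT0 : (0 : ℝ) ≤ T := by linarith
  have hb0 : (0 : ℝ) < β' := by linarith
  obtain ⟨x, hxd⟩ : ∃ x : ℝ, x = (T : ℝ) ^ (1 / β') := ⟨_, rfl⟩
  have hx : 1 ≤ x := by rw [hxd]; exact Real.one_le_rpow hT1 (by positivity)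
  have hxT : x ^ β' = T := by
    rw [hxd, ← Real.rpow_mul hT0, one_div_mul_cancel hb0.ne', Real.rpow_one]
  have hxc : (T : ℝ) ^ (-c) = x ^ (1 - β) := by
    rw [hxd, ← Real.rpow_mul hT0, hc]; congr 1; ring
  have hN1 : x ≤ (⌈x⌉₊ : ℝ) := Nat.le_ceil x
  have hN2 : ((⌈x⌉₊ : ℕ) : ℝ) ≤ 2 * x := by
    linarith [Nat.ceil_lt_add_one (by linarith : (0 : ℝ) ≤ x)]
  rw [hxc]
  exact ⟨lower_bound β β' x hβ hβ'1 T _ hx hxT hN1 hN2,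
    upper_bound β β' x hβ hβ'1 T _ hx hxT hN1 hN2⟩
end

section
/- Let β > 1, c := 1 − 1/β, and let p be the Zipf distribution with exponent β on the positive integers, p_i = i^{-β}/ζ(β). For an integer T₀ ≥ 1, set k := ⌈T₀^{1/β}⌉ (the effective tail cutoff induced by fitting the histogram of T₀ iid samples from p), and let E(T,k) := Σ_{i ≥ k+1} p_i + Σ_{i=1}^{k} p_i (1 − p_i)^T. Then there exist constants C₁, C₂ > 0 and thresholds, depending only on β, such that for all sufficiently large integers T and T₀: C₁·(T^{-c} + T₀^{-c}) ≤ E(T, ⌈T₀^{1/β}⌉) ≤ C₂·(T^{-c} + T₀^{-c}). In particular, if T₀ ≥ T then E ≍ T^{-c}, the clean-data rate. -/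
/-- Test error of the Hutter model trained on `T` iid samples from the Zipf distribution
with its tail chopped off at rank `k`:
`E(T,k) = ∑_{i ≥ k+1} p_i + ∑_{i=1}^k p_i (1-p_i)^T`. -/
noncomputable def EtestTail (β : ℝ) (T k : ℕ) : ℝ :=
  (∑' i : ℕ, if k + 1 ≤ i then zipf β i else 0) +
    ∑ i ∈ Finset.Icc 1 k, zipf β i * (1 - zipf β i) ^ T

lemma aux_tele (s x : ℝ) (hs : 0 < s) (hx : 0 < x) :
    s * (x + 1) ^ (-(s + 1)) ≤ x ^ (-s) - (x + 1) ^ (-s) := by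
  have h1 : x ^ (-s) = (x + 1) ^ (-s) * (x / (x + 1)) ^ (-s) := by
    rw [← Real.mul_rpow (by positivity) (by positivity)]
    congr 1
    field_simp
  have h2 : (x + 1) ^ (-(s + 1)) = (x + 1) ^ (-s) * (1 / (x + 1)) := by
    rw [show -(s + 1) = -s + (-1) by ring, Real.rpow_add (by positivity), Real.rpow_neg_one]
    simp
  have h3 : 1 + s * (1 / (x + 1)) ≤ (x / (x + 1)) ^ (-s) := by
    rw [Real.rpow_def_of_pos (by positivity)]
    have h4 := Real.log_le_sub_one_of_pos (show 0 < x / (x + 1) by positivity)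
    have h5 := Real.add_one_le_exp (Real.log (x / (x + 1)) * -s)
    have h6 : x / (x + 1) - 1 = - (1 / (x + 1)) := by field_simp; ring
    rw [h6] at h4
    nlinarith
  have h7 : 0 < (x + 1) ^ (-s) := by positivity
  rw [h1, h2]
  nlinarith

noncomputable def auxZ (β : ℝ) : ℝ := ∑' j : ℕ, ((j : ℝ) + 1) ^ (-β)

noncomputable def auxTail (β : ℝ) (k : ℕ) : ℝ := ∑' i : ℕ, if k + 1 ≤ i then zipf β i else 0

lemma aux_Z (β : ℝ) (hβ : 1 < β) : 1 ≤ auxZ β := by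
  have h : Summable (fun j : ℕ => ((j : ℝ) + 1) ^ (-β)) := by
    have := (summable_nat_add_iff 1).2 (Real.summable_nat_rpow.2 (show -β < -1 by linarith))
    simpa using this
  have := h.le_tsum 0 (fun j _ => by positivity)
  simpa [auxZ] using this

lemma aux_zipf (β : ℝ) (i : ℕ) : zipf β i = (i : ℝ) ^ (-β) / auxZ β := rfl

lemma aux_nonneg (β : ℝ) (hβ : 1 < β) (i : ℕ) : 0 ≤ zipf β i := by
  have := aux_Z β hβ
  rw [aux_zipf]
  positivity

lemma aux_le (β : ℝ) (hβ : 1 < β) (i : ℕ) : zipf β i ≤ (i : ℝ) ^ (-β) := by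
  have := aux_Z β hβ
  rw [aux_zipf]
  exact div_le_self (by positivity) this

lemma aux_le_one (β : ℝ) (hβ : 1 < β) (i : ℕ) : zipf β i ≤ 1 := by
  refine (aux_le β hβ i).trans ?_
  rcases Nat.eq_zero_or_pos i with h | h
  · subst h
    rw [Nat.cast_zero, Real.zero_rpow (by linarith)]
    norm_num
  · exact Real.rpow_le_one_of_one_le_of_nonpos (by exact_mod_cast h) (by linarith)

lemma aux_summable (β : ℝ) (hβ : 1 < β) : Summable (zipf β) := by
  have := (Real.summable_nat_rpow.2 (show -β < -1 by linarith)).div_const (auxZ β)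
  exact this

lemma aux_tail_nonneg (β : ℝ) (hβ : 1 < β) (k i : ℕ) :
    0 ≤ if k + 1 ≤ i then zipf β i else 0 := by
  split_ifs
  · exact aux_nonneg β hβ i
  · exact le_rfl

lemma aux_tail_summable (β : ℝ) (hβ : 1 < β) (k : ℕ) :
    Summable (fun i : ℕ => if k + 1 ≤ i then zipf β i else 0) := by
  refine Summable.of_nonneg_of_le (aux_tail_nonneg β hβ k) (fun i => ?_) (aux_summable β hβ)
  split_ifs
  · exact le_rfl
  · exact aux_nonneg β hβ i

lemma aux_tail_upper (β : ℝ) (hβ : 1 < β) (N : ℕ) (hN : 1 ≤ N) :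
    auxTail β N ≤ 1 / (β - 1) * (N : ℝ) ^ (-(β - 1)) := by
  have hs : 0 < β - 1 := by linarith
  have key : ∀ d : ℕ, ∑ i ∈ Finset.range (N + 1 + d), (if N + 1 ≤ i then zipf β i else 0) ≤
      1 / (β - 1) * ((N : ℝ) ^ (-(β - 1)) - ((N + d : ℕ) : ℝ) ^ (-(β - 1))) := by
    intro d
    induction d with
    | zero =>
      rw [Finset.sum_eq_zero]
      · simp
      · intro i hi
        rw [Finset.mem_range] at hi
        rw [if_neg (by omega)]
    | succ d ih =>
      rw [← add_assoc, Finset.sum_range_succ, if_pos (by omega)]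
      have h1 := aux_tele (β - 1) ((N + d : ℕ) : ℝ) hs (by exact_mod_cast (by omega))
      have h2 := aux_le β hβ (N + 1 + d)
      have h3 : ((N + 1 + d : ℕ) : ℝ) = ((N + d : ℕ) : ℝ) + 1 := by push_cast; ring
      have h4 : ((N + (d + 1) : ℕ) : ℝ) = ((N + d : ℕ) : ℝ) + 1 := by push_cast; ring
      rw [h3] at h2
      rw [h4]
      rw [show -(β - 1 + 1) = -β by ring] at h1
      have h5 : zipf β (N + 1 + d) ≤ 1 / (β - 1) *
          (((N + d : ℕ) : ℝ) ^ (-(β - 1)) - (((N + d : ℕ) : ℝ) + 1) ^ (-(β - 1))) := by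
        rw [one_div, ← div_eq_inv_mul, le_div_iff₀ hs]
        nlinarith
      linarith
  refine Real.tsum_le_of_sum_range_le (aux_tail_nonneg β hβ N) (fun n => ?_)
  refine (Finset.sum_le_sum_of_subset_of_nonneg (Finset.range_mono (show n ≤ N + 1 + n by omega))
    (fun i _ _ => aux_tail_nonneg β hβ N i)).trans ((key n).trans ?_)
  have : 0 ≤ ((N + n : ℕ) : ℝ) ^ (-(β - 1)) := by positivity
  exact mul_le_mul_of_nonneg_left (by linarith) (by positivity)

lemma aux_tail_lower (β : ℝ) (hβ : 1 < β) (N : ℕ) (hN : 1 ≤ N) :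
    2 ^ (-β) / auxZ β * (N : ℝ) ^ (-(β - 1)) ≤ auxTail β N := by
  have hZ := aux_Z β hβ
  have hN' : (0 : ℝ) < N := by exact_mod_cast hN
  refine le_trans ?_ ((aux_tail_summable β hβ N).sum_le_tsum (Finset.Ioc N (2 * N))
    (fun i _ => aux_tail_nonneg β hβ N i))
  have : ∀ i ∈ Finset.Ioc N (2 * N), ((2 : ℝ) * N) ^ (-β) / auxZ β ≤
      if N + 1 ≤ i then zipf β i else 0 := by
    intro i hi
    rw [Finset.mem_Ioc] at hi
    rw [if_pos (by omega), aux_zipf]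
    have hi0 : (0 : ℝ) < i := by exact_mod_cast (by omega)
    refine div_le_div_of_nonneg_right ?_ (by linarith)
    exact Real.rpow_le_rpow_of_nonpos hi0 (by exact_mod_cast hi.2) (by linarith)
  refine le_trans (le_of_eq ?_) (Finset.card_nsmul_le_sum _ _ _ this)
  rw [Nat.card_Ioc, show 2 * N - N = N by omega, nsmul_eq_mul,
    Real.mul_rpow (by norm_num) hN'.le, show -(β - 1) = 1 + -β by ring, Real.rpow_add hN',
    Real.rpow_one]
  ring

lemma aux_ceil (β : ℝ) (hβ : 1 < β) (X : ℕ) (hX : 1 ≤ X) :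
    1 ≤ ⌈(X : ℝ) ^ (1 / β)⌉₊ ∧
    (X : ℝ) ^ (1 / β) ≤ (⌈(X : ℝ) ^ (1 / β)⌉₊ : ℝ) ∧
    (⌈(X : ℝ) ^ (1 / β)⌉₊ : ℝ) ≤ 2 * (X : ℝ) ^ (1 / β) ∧
    (⌈(X : ℝ) ^ (1 / β)⌉₊ : ℝ) ^ (-(β - 1)) ≤ (X : ℝ) ^ (-(1 - 1 / β)) ∧
    2 ^ (-(β - 1)) * (X : ℝ) ^ (-(1 - 1 / β)) ≤ (⌈(X : ℝ) ^ (1 / β)⌉₊ : ℝ) ^ (-(β - 1)) := by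
  have hX' : (1 : ℝ) ≤ X := by exact_mod_cast hX
  have hβ0 : 0 < β := by linarith
  have h1 : (1 : ℝ) ≤ (X : ℝ) ^ (1 / β) := Real.one_le_rpow hX' (by positivity)
  have h2 := Nat.le_ceil ((X : ℝ) ^ (1 / β))
  have h3 := Nat.ceil_lt_add_one (show 0 ≤ (X : ℝ) ^ (1 / β) by positivity)
  have h4 : ((X : ℝ) ^ (1 / β)) ^ (-(β - 1)) = (X : ℝ) ^ (-(1 - 1 / β)) := by
    rw [← Real.rpow_mul (by positivity)]
    congr 1
    field_simp
  refine ⟨by exact_mod_cast h1.trans h2, h2, by linarith, ?_, ?_⟩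
  · rw [← h4]
    exact Real.rpow_le_rpow_of_nonpos (by linarith) h2 (by linarith)
  · rw [← h4, ← Real.mul_rpow (by norm_num) (by positivity)]
    exact Real.rpow_le_rpow_of_nonpos (by linarith) (by linarith) (by linarith)

lemma aux_inv (p : ℝ) (h0 : 0 ≤ p) (h1 : p ≤ 1) (T : ℕ) (hT : 1 ≤ T) :
    p * (1 - p) ^ T ≤ 1 / T := by
  have hT' : (0 : ℝ) < T := by exact_mod_cast hT
  have a := one_add_mul_le_pow (show -2 ≤ p by linarith) T
  have b : (1 - p) ^ T * (1 + p) ^ T ≤ 1 := by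
    rw [← mul_pow]
    exact pow_le_one₀ (by nlinarith) (by nlinarith)
  have c : 0 ≤ (1 - p) ^ T := pow_nonneg (by linarith) T
  rw [le_div_iff₀ hT']
  nlinarith

lemma aux_E_upper (β : ℝ) (hβ : 1 < β) (T k m : ℕ) (hT : 1 ≤ T) :
    EtestTail β T k ≤ auxTail β k + (m / T + auxTail β m) := by
  unfold EtestTail
  refine add_le_add le_rfl ?_
  have h : ∀ i ∈ Finset.Icc 1 k, zipf β i * (1 - zipf β i) ^ T ≤
      (if i ∈ Finset.Icc 1 m then 1 / (T : ℝ) else 0) + (if m + 1 ≤ i then zipf β i else 0) := by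
    intro i hi
    have h0 := aux_nonneg β hβ i
    have h1 := aux_le_one β hβ i
    rw [Finset.mem_Icc] at *
    by_cases him : i ≤ m
    · rw [if_pos (Finset.mem_Icc.2 ⟨hi.1, him⟩), if_neg (by omega), add_zero]
      exact aux_inv _ h0 h1 T hT
    · rw [if_neg (by rw [Finset.mem_Icc]; omega), if_pos (by omega), zero_add]
      exact mul_le_of_le_one_right h0 (pow_le_one₀ (by linarith) (by linarith))
  refine (Finset.sum_le_sum h).trans ?_
  rw [Finset.sum_add_distrib]
  refine add_le_add ?_ ((aux_tail_summable β hβ m).sum_le_tsum _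
    (fun i _ => aux_tail_nonneg β hβ m i))
  rw [Finset.sum_ite_mem, Finset.sum_const, nsmul_eq_mul, mul_one_div]
  gcongr
  have := Finset.card_le_card (Finset.inter_subset_right (s₁ := Finset.Icc 1 k)
    (s₂ := Finset.Icc 1 m))
  simpa using this

lemma aux_E_ge_tail (β : ℝ) (hβ : 1 < β) (T k : ℕ) : auxTail β k ≤ EtestTail β T k := by
  unfold EtestTail
  refine le_add_of_nonneg_right (Finset.sum_nonneg fun i _ => ?_)
  have h0 := aux_nonneg β hβ i
  have h1 := aux_le_one β hβ i
  exact mul_nonneg h0 (pow_nonneg (by linarith) _)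

lemma aux_E_lower (β : ℝ) (hβ : 1 < β) (T k M : ℕ)
    (h : ∀ i, M + 1 ≤ i → T * zipf β i ≤ 1 / 2) :
    1 / 2 * auxTail β M ≤ EtestTail β T k := by
  have e : ∑ i ∈ Finset.Icc 1 k, zipf β i * (1 - zipf β i) ^ T =
      ∑' i, if i ∈ Finset.Icc 1 k then zipf β i * (1 - zipf β i) ^ T else 0 := by
    rw [tsum_eq_sum (s := Finset.Icc 1 k)]
    · exact Finset.sum_congr rfl fun i hi => by rw [if_pos hi]
    · intro i hi
      rw [if_neg hi]
  have sm : Summable (fun i => if i ∈ Finset.Icc 1 k then zipf β i * (1 - zipf β i) ^ T else 0) :=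
    summable_of_ne_finset_zero (s := Finset.Icc 1 k) (fun i hi => by rw [if_neg hi])
  unfold EtestTail
  rw [e, ← (aux_tail_summable β hβ k).tsum_add sm]
  unfold auxTail
  rw [← tsum_mul_left]
  refine ((aux_tail_summable β hβ M).mul_left _).tsum_le_tsum (fun i => ?_)
    ((aux_tail_summable β hβ k).add sm)
  have h0 := aux_nonneg β hβ i
  have h1 := aux_le_one β hβ i
  have h2 : 0 ≤ zipf β i * (1 - zipf β i) ^ T := mul_nonneg h0 (pow_nonneg (by linarith) _)
  by_cases hM : M + 1 ≤ i
  · rw [if_pos hM]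
    by_cases hk : k + 1 ≤ i
    · rw [if_pos hk, if_neg (by rw [Finset.mem_Icc]; omega)]
      linarith
    · rw [if_neg hk, if_pos (by rw [Finset.mem_Icc]; omega), zero_add]
      have a := one_add_mul_le_pow (show -2 ≤ -zipf β i by linarith) T
      have b := h i hM
      rw [← sub_eq_add_neg] at a
      nlinarith
  · rw [if_neg hM, mul_zero]
    refine add_nonneg (aux_tail_nonneg β hβ k i) ?_
    split_ifs
    · exact h2
    · exact le_rfl

lemma aux_upper (β : ℝ) (hβ : 1 < β) (T T₀ : ℕ) (hT : 1 ≤ T) (hT₀ : 1 ≤ T₀) :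
    EtestTail β T ⌈(T₀ : ℝ) ^ (1 / β)⌉₊ ≤ (1 / (β - 1) + 2) *
      ((T : ℝ) ^ (-(1 - 1 / β)) + (T₀ : ℝ) ^ (-(1 - 1 / β))) := by
  have hs : 0 < β - 1 := by linarith
  have hT' : (0 : ℝ) < T := by exact_mod_cast hT
  obtain ⟨a1, a2, a3, a4, a5⟩ := aux_ceil β hβ T₀ hT₀
  obtain ⟨b1, b2, b3, b4, b5⟩ := aux_ceil β hβ T hT
  have u := aux_E_upper β hβ T ⌈(T₀ : ℝ) ^ (1 / β)⌉₊ ⌈(T : ℝ) ^ (1 / β)⌉₊ hT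
  have v := aux_tail_upper β hβ _ a1
  have w := aux_tail_upper β hβ _ b1
  have hp : 0 < 1 / (β - 1) := by positivity
  have v' := mul_le_mul_of_nonneg_left a4 hp.le
  have w' := mul_le_mul_of_nonneg_left b4 hp.le
  have x : (⌈(T : ℝ) ^ (1 / β)⌉₊ : ℝ) / T ≤ 2 * (T : ℝ) ^ (-(1 - 1 / β)) := by
    rw [div_le_iff₀ hT', show -(1 - 1 / β) = 1 / β - 1 by ring, Real.rpow_sub_one hT'.ne']
    field_simp
    linarith
  have y : 0 < (T₀ : ℝ) ^ (-(1 - 1 / β)) := by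
    have : (0 : ℝ) < T₀ := by exact_mod_cast hT₀
    positivity
  nlinarith

lemma aux_lower (β : ℝ) (hβ : 1 < β) :
    ∃ C : ℝ, 0 < C ∧ ∀ T T₀ : ℕ, 1 ≤ T → 1 ≤ T₀ →
      C * ((T : ℝ) ^ (-(1 - 1 / β)) + (T₀ : ℝ) ^ (-(1 - 1 / β))) ≤
        EtestTail β T ⌈(T₀ : ℝ) ^ (1 / β)⌉₊ := by
  have hZ := aux_Z β hβ
  obtain ⟨A, hA, hAdef⟩ : ∃ A : ℝ, 0 < A ∧ A = 2 ^ (-β) / auxZ β := ⟨_, by positivity, rfl⟩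
  obtain ⟨B, hB, hBdef⟩ : ∃ B : ℝ, 0 < B ∧ B = 2 ^ (-(β - 1)) := ⟨_, by positivity, rfl⟩
  have hC1 : 0 < A * B := by positivity
  have hC2 : 0 < 1 / 2 * (A * (B * B)) := by positivity
  refine ⟨min (A * B) (1 / 2 * (A * (B * B))) / 2, by have := lt_min hC1 hC2; linarith, ?_⟩
  intro T T₀ hT hT₀
  have hT' : (0 : ℝ) < T := by exact_mod_cast hT
  have hT₀' : (0 : ℝ) < T₀ := by exact_mod_cast hT₀
  obtain ⟨a1, a2, a3, a4, a5⟩ := aux_ceil β hβ T₀ hT₀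
  obtain ⟨b1, b2, b3, b4, b5⟩ := aux_ceil β hβ T hT
  set k := ⌈(T₀ : ℝ) ^ (1 / β)⌉₊
  set m := ⌈(T : ℝ) ^ (1 / β)⌉₊
  have hm : (0 : ℝ) < m := by exact_mod_cast b1
  have e1 : A * B * (T₀ : ℝ) ^ (-(1 - 1 / β)) ≤ EtestTail β T k := by
    refine le_trans ?_ ((aux_tail_lower β hβ k a1).trans (aux_E_ge_tail β hβ T k))
    rw [← hAdef, mul_assoc]
    rw [← hBdef] at a5
    exact mul_le_mul_of_nonneg_left a5 hA.le
  have e2 : 1 / 2 * (A * (B * B)) * (T : ℝ) ^ (-(1 - 1 / β)) ≤ EtestTail β T k := by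
    have hl := aux_tail_lower β hβ (2 * m) (by omega)
    refine le_trans ?_ (aux_E_lower β hβ T k (2 * m) ?_)
    · rw [← hAdef] at hl
      push_cast at hl
      rw [Real.mul_rpow (by norm_num) hm.le, ← hBdef] at hl
      rw [← hBdef] at b5
      have := mul_le_mul_of_nonneg_left b5 (show 0 ≤ A * B by positivity)
      nlinarith
    · intro i hi
      have h1 := aux_le β hβ i
      have h2 : (i : ℝ) ^ (-β) ≤ (2 * (T : ℝ) ^ (1 / β)) ^ (-β) := by
        refine Real.rpow_le_rpow_of_nonpos (by positivity) ?_ (by linarith)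
        have : ((2 * m : ℕ) : ℝ) ≤ i := by exact_mod_cast (by omega)
        push_cast at this
        linarith
      rw [Real.mul_rpow (by norm_num) (by positivity), ← Real.rpow_mul hT'.le,
        show 1 / β * -β = -1 by field_simp, Real.rpow_neg_one] at h2
      have h3 : (2 : ℝ) ^ (-β) ≤ 2 ^ (-1 : ℝ) :=
        Real.rpow_le_rpow_of_exponent_le (by norm_num) (by linarith)
      rw [Real.rpow_neg_one] at h3
      calc (T : ℝ) * zipf β i ≤ T * (2 ^ (-β) * (T : ℝ)⁻¹) :=
            mul_le_mul_of_nonneg_left (h1.trans h2) hT'.le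
        _ = 2 ^ (-β) := by field_simp
        _ ≤ 1 / 2 := by rw [one_div]; exact h3
  have p1 : 0 < (T : ℝ) ^ (-(1 - 1 / β)) := by positivity
  have p2 : 0 < (T₀ : ℝ) ^ (-(1 - 1 / β)) := by positivity
  have q1 := mul_le_mul_of_nonneg_right (min_le_left (A * B) (1 / 2 * (A * (B * B)))) p2.le
  have q2 := mul_le_mul_of_nonneg_right (min_le_right (A * B) (1 / 2 * (A * (B * B)))) p1.le
  linarith

/-- For `β > 1`, `c = 1 - 1/β`, if the tail cutoff induced by an AI
generator trained on `T₀` samples is `k = ⌈T₀^(1/β)⌉`, then the downstream Hutter model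
trained on `T` samples satisfies `E(T,k) ≍ T^(-c) + T₀^(-c)` for all large `T, T₀`;
in particular if `T₀ ≥ T` then `E ≍ T^(-c)`, the clean-data rate. -/
theorem collapse_in_terms_of_T0 (β : ℝ) (hβ : 1 < β) (c : ℝ) (hc : c = 1 - 1 / β) :
    ∃ C₁ C₂ : ℝ, 0 < C₁ ∧ 0 < C₂ ∧ ∃ T₁ T₂ : ℕ,
      (∀ T T₀ : ℕ, T₁ ≤ T → T₂ ≤ T₀ →
        C₁ * ((T : ℝ) ^ (-c) + (T₀ : ℝ) ^ (-c)) ≤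
            EtestTail β T ⌈(T₀ : ℝ) ^ (1 / β)⌉₊ ∧
        EtestTail β T ⌈(T₀ : ℝ) ^ (1 / β)⌉₊ ≤
            C₂ * ((T : ℝ) ^ (-c) + (T₀ : ℝ) ^ (-c))) ∧
      ∃ D₁ D₂ : ℝ, 0 < D₁ ∧ 0 < D₂ ∧
      (∀ T T₀ : ℕ, T₁ ≤ T → T₂ ≤ T₀ → T ≤ T₀ →
        D₁ * (T : ℝ) ^ (-c) ≤ EtestTail β T ⌈(T₀ : ℝ) ^ (1 / β)⌉₊ ∧
        EtestTail β T ⌈(T₀ : ℝ) ^ (1 / β)⌉₊ ≤ D₂ * (T : ℝ) ^ (-c)) := by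
  subst hc
  obtain ⟨C, hC, hlow⟩ := aux_lower β hβ
  have hs : 0 < 1 / (β - 1) := one_div_pos.2 (by linarith)
  have hc0 : 1 / β ≤ 1 := by rw [div_le_one (by linarith)]; linarith
  refine ⟨C, 1 / (β - 1) + 2, hC, by linarith, 1, 1,
    fun T T₀ hT hT₀ => ⟨hlow T T₀ hT hT₀, aux_upper β hβ T T₀ hT hT₀⟩,
    C, 2 * (1 / (β - 1) + 2), hC, by linarith, fun T T₀ hT hT₀ hTT => ?_⟩
  have l := hlow T T₀ hT hT₀
  have u := aux_upper β hβ T T₀ hT hT₀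
  have hT' : (0 : ℝ) < T := by exact_mod_cast hT
  have hT₀' : (0 : ℝ) < T₀ := by exact_mod_cast hT₀
  have p2 : 0 < (T₀ : ℝ) ^ (-(1 - 1 / β)) := by positivity
  have h : (T₀ : ℝ) ^ (-(1 - 1 / β)) ≤ (T : ℝ) ^ (-(1 - 1 / β)) :=
    Real.rpow_le_rpow_of_nonpos hT' (by exact_mod_cast hTT) (by linarith)
  constructor
  · nlinarith
  · nlinarith
end

section
/- Fix β ∈ (1,2) and set c := 1 − 1/β. Let p = (p_i) be a probability distribution on the positive integers with Σ_i p_i^{1−c} < ∞, and suppose the maps π_i are bijections of the positive integers (permutations), with true conditional distributions p(j|i) := π_i(j)^{-β}/ζ(β). Suppose the training pairs (i_t, j_t) are iid with i_t ~ p and j_t drawn from the truncated conditional p_k(j|i_t) ∝ π_{i_t}(j)^{-β}·1[π_{i_t}(j) ≤ k]. Then there exist constants C₁, C₂ > 0 and T₀, depending only on β and p, such that for all T ≥ T₀ and all sufficiently large k: C₁·(T^{-c} + k^{-βc}) ≤ E_test(T) ≤ C₂·(T^{-c} + k^{-βc}). Thus model collapse in the autoregressive bigram setting manifests as an irreducible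 plateau of order k^{-βc}. -/
open MeasureTheory

/-- The discrete measurable structure on the positive integers. -/
instance : MeasurableSpace ℕ+ := ⊤

/-- True conditional next-token distribution of the tailed bigram (Hutter++) model with
permutations: `p(j|i) = π_i(j)^(-β) / ζ(β)` where `ζ(β) = ∑_{m ≥ 1} m^(-β)`. -/
noncomputable def condP (β : ℝ) (πm : ℕ+ → ℕ+ → ℕ+) (i j : ℕ+) : ℝ :=
  ((πm i j : ℕ) : ℝ) ^ (-β) / ∑' m : ℕ+, ((m : ℕ) : ℝ) ^ (-β)

/-- Truncated (tail-chopped at rank `k`) conditional distribution of AI-generated data: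
`p_k(j|i) ∝ π_i(j)^(-β) · 1[π_i(j) ≤ k]`. -/
noncomputable def condK (β : ℝ) (k : ℕ) (πm : ℕ+ → ℕ+ → ℕ+) (i j : ℕ+) : ℝ :=
  (if (πm i j : ℕ) ≤ k then ((πm i j : ℕ) : ℝ) ^ (-β) else 0) /
    ∑' j' : ℕ+, (if (πm i j' : ℕ) ≤ k then ((πm i j' : ℕ) : ℝ) ^ (-β) else 0)

/-- `n_T(i)`: number of occurrences of the context `i` in the sample `s`. -/
def nCtx {T : ℕ} (s : Fin T → ℕ+ × ℕ+) (i : ℕ+) : ℕ :=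
  (Finset.univ.filter fun t => (s t).1 = i).card

/-- `n_T(i,j)`: number of occurrences of the pair `(i,j)` in the sample `s`. -/
def nPair {T : ℕ} (s : Fin T → ℕ+ × ℕ+) (i j : ℕ+) : ℕ :=
  (Finset.univ.filter fun t => s t = (i, j)).card

/-- The empirical conditional `q_T(j|i) = n_T(i,j)/n_T(i)` if `n_T(i) ≥ 1`, else `0`. -/
noncomputable def qEmp {T : ℕ} (s : Fin T → ℕ+ × ℕ+) (i j : ℕ+) : ℝ :=
  if 1 ≤ nCtx s i then (nPair s i j : ℝ) / (nCtx s i : ℝ) else 0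

/-- The TV-based test error `E_test(T) = ∑_i p_i 𝔼[∑_j |q_T(j|i) − cond(j|i)|]`, the
expectation being over a training set of `T` iid pairs drawn from the measure `μ`. -/
noncomputable def EtestBigram (p : ℕ+ → ℝ) (cond : ℕ+ → ℕ+ → ℝ)
    (μ : Measure (ℕ+ × ℕ+)) (T : ℕ) : ℝ :=
  ∑' i : ℕ+, p i *
    ∫ s : Fin T → ℕ+ × ℕ+, (∑' j : ℕ+, |qEmp s i j - cond i j|)
      ∂(Measure.pi fun _ : Fin T => μ)

lemma aux_head (s : ℝ) (hs0 : 0 < s) (hs1 : s < 1) (r : ℕ) :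
    (1 - s) * ((r : ℝ) + 1) ^ (-s) ≤ ((r : ℝ) + 1) ^ (1 - s) - (r : ℝ) ^ (1 - s) := by
  have hr : (0 : ℝ) < (r : ℝ) + 1 := by positivity
  have h1 : -1 ≤ -(1 / ((r : ℝ) + 1)) := by
    have : 1 / ((r : ℝ) + 1) ≤ 1 := by
      rw [div_le_one hr]; linarith [(Nat.cast_nonneg r : (0 : ℝ) ≤ r)]
    linarith
  have h := rpow_one_add_le_one_add_mul_self h1 (p := 1 - s) (by linarith) (by linarith)
  have e : 1 + -(1 / ((r : ℝ) + 1)) = r / ((r : ℝ) + 1) := by field_simp; ring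
  rw [e, Real.div_rpow (by positivity) hr.le, div_le_iff₀ (by positivity)] at h
  have e2 : ((r : ℝ) + 1) ^ (1 - s) = ((r : ℝ) + 1) ^ (-s) * ((r : ℝ) + 1) := by
    rw [← Real.rpow_add_one hr.ne']; congr 1; ring
  have e3 : (1 + (1 - s) * -(1 / ((r : ℝ) + 1))) * ((r : ℝ) + 1) ^ (1 - s)
      = ((r : ℝ) + 1) ^ (1 - s) - (1 - s) * ((r : ℝ) + 1) ^ (-s) := by
    rw [e2]; field_simp; ring
  linarith

lemma aux_tail (β : ℝ) (h1 : 1 < β) (h2 : β < 2) (r : ℕ) (hr1 : 1 ≤ r) :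
    (β - 1) * ((r : ℝ) + 1) ^ (-β) ≤ (r : ℝ) ^ (1 - β) - ((r : ℝ) + 1) ^ (1 - β) := by
  have hr0 : (0 : ℝ) < r := by exact_mod_cast hr1
  have hr : (0 : ℝ) < (r : ℝ) + 1 := by positivity
  have h := aux_head (2 - β) (by linarith) (by linarith) r
  -- a = β - 1 : a (r+1)^(a-1) ≤ (r+1)^a - r^a
  have e1 : (1 - (2 - β)) = β - 1 := by ring
  have e2 : ((r : ℝ) + 1) ^ (-(2 - β)) = ((r : ℝ) + 1) ^ (β - 1) / (r + 1) := by
    rw [← Real.rpow_sub_one hr.ne']; congr 1; ring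
  have e3 : ((r : ℝ) + 1) ^ (-β) = (((r : ℝ) + 1) ^ (β - 1))⁻¹ / (r + 1) := by
    rw [← Real.rpow_neg hr.le, ← Real.rpow_sub_one hr.ne']; congr 1; ring
  have e4 : ((r : ℝ) + 1) ^ (1 - β) = (((r : ℝ) + 1) ^ (β - 1))⁻¹ := by
    rw [← Real.rpow_neg hr.le]; congr 1; ring
  have e5 : (r : ℝ) ^ (1 - β) = ((r : ℝ) ^ (β - 1))⁻¹ := by
    rw [← Real.rpow_neg hr0.le]; congr 1; ring
  rw [e1, e2] at h
  rw [e3, e4, e5]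
  have hx : 0 < ((r : ℝ) + 1) ^ (β - 1) := by positivity
  have hy : 0 < (r : ℝ) ^ (β - 1) := by positivity
  have hxy : (r : ℝ) ^ (β - 1) ≤ ((r : ℝ) + 1) ^ (β - 1) :=
    Real.rpow_le_rpow hr0.le (by linarith) (by linarith)
  generalize ((r : ℝ) + 1) ^ (β - 1) = x at *
  generalize (r : ℝ) ^ (β - 1) = y at *
  have e6 : y⁻¹ - x⁻¹ = (x - y) / (x * y) := by field_simp
  rw [e6, le_div_iff₀ (by positivity)]
  have e7 : (β - 1) * (x⁻¹ / ((r : ℝ) + 1)) * (x * y) = (β - 1) * (y / (r + 1)) := by field_simp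
  rw [e7]
  refine le_trans ?_ h
  have : 0 < β - 1 := by linarith
  gcongr

lemma aux_sum (β A B : ℝ) (h1 : 1 < β) (h2 : β < 2) (hA : 0 ≤ A) (hB : 0 ≤ B) (N : ℕ) (hN : 1 ≤ N)
    (g : ℕ → ℝ) (hg1 : ∀ r, r < N → g r ≤ A * ((r : ℝ) + 1) ^ (-(β / 2)))
    (hg2 : ∀ r, N ≤ r → g r ≤ B * ((r : ℝ) + 1) ^ (-β)) (M : ℕ) :
    ∑ r ∈ Finset.range M, g r ≤
      A * ((N : ℝ) ^ (1 - β / 2) / (1 - β / 2)) + B * ((N : ℝ) ^ (1 - β) / (β - 1)) := by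
  have hs : 0 < 1 - β / 2 := by linarith
  have hb : 0 < β - 1 := by linarith
  have step1 : ∀ M : ℕ, M ≤ N → ∑ r ∈ Finset.range M, g r ≤
      A * ((M : ℝ) ^ (1 - β / 2) / (1 - β / 2)) := by
    intro M
    induction M with
    | zero => intro _; simp; positivity
    | succ M ih =>
      intro hM
      rw [Finset.sum_range_succ]
      have i1 := ih (by omega)
      have i2 := hg1 M (by omega)
      have i3 := aux_head (β / 2) (by linarith) (by linarith) M
      have i4 : ((M : ℝ) + 1) ^ (-(β / 2)) ≤ (((M : ℝ) + 1) ^ (1 - β / 2) - (M : ℝ) ^ (1 - β / 2)) / (1 - β / 2) := by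
        rw [le_div_iff₀ hs]; linarith
      have i5 := mul_le_mul_of_nonneg_left i4 hA
      rw [sub_div, mul_sub] at i5
      push_cast
      linarith
  have step2 : ∀ d : ℕ, ∑ r ∈ Finset.range (N + d), g r ≤
      A * ((N : ℝ) ^ (1 - β / 2) / (1 - β / 2)) +
        B * (((N : ℝ) ^ (1 - β) - ((N + d : ℕ) : ℝ) ^ (1 - β)) / (β - 1)) := by
    intro d
    induction d with
    | zero => simpa using step1 N le_rfl
    | succ d ih =>
      rw [← add_assoc, Finset.sum_range_succ]
      have i2 := hg2 (N + d) (by omega)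
      have i3 := aux_tail β h1 h2 (N + d) (by omega)
      have i4 : (((N + d : ℕ) : ℝ) + 1) ^ (-β) ≤
          (((N + d : ℕ) : ℝ) ^ (1 - β) - (((N + d : ℕ) : ℝ) + 1) ^ (1 - β)) / (β - 1) := by
        rw [le_div_iff₀ hb]; linarith
      have i5 := mul_le_mul_of_nonneg_left i4 hB
      rw [sub_div, mul_sub] at i5 ih ⊢
      have e : ((N + d + 1 : ℕ) : ℝ) = ((N + d : ℕ) : ℝ) + 1 := by push_cast; ring
      rw [e]
      linarith
  rcases le_total M N with h | h
  · have i1 := step1 M h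
    have : (M : ℝ) ^ (1 - β / 2) ≤ (N : ℝ) ^ (1 - β / 2) :=
      Real.rpow_le_rpow (by positivity) (by exact_mod_cast h) hs.le
    have : A * ((M : ℝ) ^ (1 - β / 2) / (1 - β / 2)) ≤ A * ((N : ℝ) ^ (1 - β / 2) / (1 - β / 2)) := by
      gcongr
    have : 0 ≤ B * ((N : ℝ) ^ (1 - β) / (β - 1)) := by positivity
    linarith
  · obtain ⟨d, rfl⟩ := Nat.exists_eq_add_of_le h
    refine (step2 d).trans ?_
    gcongr
    have : 0 ≤ ((N + d : ℕ) : ℝ) ^ (1 - β) := by positivity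
    linarith

lemma aux_pnat (β A B : ℝ) (h1 : 1 < β) (h2 : β < 2) (hA : 0 ≤ A) (hB : 0 ≤ B) (N : ℕ) (hN : 1 ≤ N)
    (e : ℕ+ → ℕ+) (he : Function.Bijective e) (f : ℕ+ → ℝ) (hf : ∀ j, 0 ≤ f j)
    (hf1 : ∀ j, (e j : ℕ) ≤ N → f j ≤ A * ((e j : ℕ) : ℝ) ^ (-(β / 2)))
    (hf2 : ∀ j, N < (e j : ℕ) → f j ≤ B * ((e j : ℕ) : ℝ) ^ (-β)) :
    Summable f ∧ ∑' j, f j ≤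
      A * ((N : ℝ) ^ (1 - β / 2) / (1 - β / 2)) + B * ((N : ℝ) ^ (1 - β) / (β - 1)) := by
  let E : ℕ+ ≃ ℕ := (Equiv.ofBijective e he).trans Equiv.pnatEquivNat
  have key : ∀ r : ℕ, ((e (E.symm r) : ℕ)) = r + 1 := by
    intro r
    have : E (E.symm r) = r := E.apply_symm_apply r
    have h3 : (e (E.symm r)).natPred = r := this
    rw [← PNat.natPred_add_one, h3]
  have hb := aux_sum β A B h1 h2 hA hB N hN (fun r => f (E.symm r))
    (by
      intro r hr
      have := hf1 (E.symm r) (by rw [key]; omega)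
      rw [key] at this; push_cast at this; exact this)
    (by
      intro r hr
      have := hf2 (E.symm r) (by rw [key]; omega)
      rw [key] at this; push_cast at this; exact this)
  have hs : Summable (fun r => f (E.symm r)) := summable_of_sum_range_le (fun r => hf _) hb
  refine ⟨(Equiv.summable_iff E.symm).1 hs, ?_⟩
  rw [← Equiv.tsum_eq E.symm]
  exact Real.tsum_le_of_sum_range_le (fun r => hf _) hb

lemma zeta_facts (β : ℝ) (h1 : 1 < β) (h2 : β < 2) (e : ℕ+ → ℕ+) (he : Function.Bijective e) :
    Summable (fun j : ℕ+ => ((e j : ℕ) : ℝ) ^ (-β)) ∧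
    (∑' j : ℕ+, ((e j : ℕ) : ℝ) ^ (-β)) = (∑' m : ℕ+, ((m : ℕ) : ℝ) ^ (-β)) := by
  constructor
  · refine (aux_pnat β 1 1 h1 h2 zero_le_one zero_le_one 1 le_rfl e he _ (fun j => by positivity)
      ?_ ?_).1
    · intro j hj
      have : (e j : ℕ) = 1 := le_antisymm hj (e j).2
      simp [this]
    · intro j _; simp
  · exact (Equiv.ofBijective e he).tsum_eq (fun m : ℕ+ => ((m : ℕ) : ℝ) ^ (-β))

lemma zetaK_facts (β : ℝ) (h1 : 1 < β) (h2 : β < 2) (e : ℕ+ → ℕ+) (he : Function.Bijective e)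
    (k : ℕ) (hk : 1 ≤ k) :
    Summable (fun j : ℕ+ => if (e j : ℕ) ≤ k then ((e j : ℕ) : ℝ) ^ (-β) else 0) ∧
    1 ≤ (∑' j : ℕ+, if (e j : ℕ) ≤ k then ((e j : ℕ) : ℝ) ^ (-β) else 0) ∧
    (∑' j : ℕ+, if (e j : ℕ) ≤ k then ((e j : ℕ) : ℝ) ^ (-β) else 0) ≤
      (∑' m : ℕ+, ((m : ℕ) : ℝ) ^ (-β)) := by
  obtain ⟨hs, ht⟩ := zeta_facts β h1 h2 e he
  have hnn : ∀ j : ℕ+, 0 ≤ (if (e j : ℕ) ≤ k then ((e j : ℕ) : ℝ) ^ (-β) else 0) := by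
    intro j; split_ifs <;> positivity
  have hle : ∀ j : ℕ+, (if (e j : ℕ) ≤ k then ((e j : ℕ) : ℝ) ^ (-β) else 0) ≤
      ((e j : ℕ) : ℝ) ^ (-β) := by
    intro j; split_ifs
    · exact le_rfl
    · positivity
  have hS := Summable.of_nonneg_of_le hnn hle hs
  refine ⟨hS, ?_, ?_⟩
  · obtain ⟨j, hj⟩ := he.2 1
    have := hS.le_tsum j (fun i _ => hnn i)
    simp only [hj, PNat.one_coe, hk, if_true] at this
    simpa using this
  · rw [← ht]
    exact hS.tsum_le_tsum hle hs

lemma zeta_ge_one_s13 (β : ℝ) (h1 : 1 < β) (h2 : β < 2) : 1 ≤ ∑' m : ℕ+, ((m : ℕ) : ℝ) ^ (-β) := by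
  have := zetaK_facts β h1 h2 id Function.bijective_id 1 le_rfl
  linarith [this.2.1, this.2.2]

section facts
variable (β : ℝ) (h1 : 1 < β) (h2 : β < 2) (πm : ℕ+ → ℕ+ → ℕ+) (i : ℕ+)
  (hπ : Function.Bijective (πm i)) (k : ℕ) (hk : 1 ≤ k)
include h1 h2

lemma condP_nonneg (j : ℕ+) : 0 ≤ condP β πm i j := by
  have := zeta_ge_one_s13 β h1 h2
  unfold condP; positivity

include hπ

lemma condP_hasSum : HasSum (condP β πm i) 1 := by
  have hz := zeta_ge_one_s13 β h1 h2
  obtain ⟨hs, ht⟩ := zeta_facts β h1 h2 _ hπ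
  have := hs.hasSum.div_const (∑' m : ℕ+, ((m : ℕ) : ℝ) ^ (-β))
  rw [ht, div_self (by linarith)] at this
  exact this

omit hπ in
lemma condP_le (j : ℕ+) : condP β πm i j ≤ ((πm i j : ℕ) : ℝ) ^ (-β) := by
  have hz := zeta_ge_one_s13 β h1 h2
  exact div_le_self (by positivity) hz

include hk
lemma condK_nonneg (j : ℕ+) : 0 ≤ condK β k πm i j := by
  have := (zetaK_facts β h1 h2 _ hπ k hk).2.1
  unfold condK
  apply div_nonneg _ (by linarith)
  split_ifs <;> positivity

lemma condK_hasSum : HasSum (condK β k πm i) 1 := by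
  have hz := zetaK_facts β h1 h2 _ hπ k hk
  have := hz.1.hasSum.div_const (∑' j : ℕ+, if (πm i j : ℕ) ≤ k then ((πm i j : ℕ) : ℝ) ^ (-β) else 0)
  rw [div_self (by linarith [hz.2.1])] at this
  exact this

lemma condK_le (j : ℕ+) : condK β k πm i j ≤ ((πm i j : ℕ) : ℝ) ^ (-β) := by
  have hz := (zetaK_facts β h1 h2 _ hπ k hk).2.1
  unfold condK
  refine (div_le_self (by split_ifs <;> positivity) hz).trans ?_
  split_ifs
  · exact le_rfl
  · positivity

omit h1 h2 hπ hk in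
lemma condK_eq_zero (j : ℕ+) (hj : k < (πm i j : ℕ)) : condK β k πm i j = 0 := by
  unfold condK; rw [if_neg (by omega)]; simp

lemma condP_le_condK (j : ℕ+) (hj : (πm i j : ℕ) ≤ k) : condP β πm i j ≤ condK β k πm i j := by
  have hz := zetaK_facts β h1 h2 _ hπ k hk
  unfold condK condP; rw [if_pos hj]
  have := hz.2.1
  exact div_le_div_of_nonneg_left (by positivity) (by linarith) hz.2.2

lemma condK_sub_condP : Summable (fun j => |condK β k πm i j - condP β πm i j|) ∧
    ∑' j, |condK β k πm i j - condP β πm i j| ≤ 2 / (β - 1) * (k : ℝ) ^ (1 - β) := by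
  have hP := condP_hasSum β h1 h2 πm i hπ
  have hK := condK_hasSum β h1 h2 πm i hπ k hk
  have hPn := condP_nonneg β h1 h2 πm i
  obtain ⟨hts, htl⟩ := aux_pnat β 0 1 h1 h2 le_rfl zero_le_one k hk (πm i) hπ
    (fun j => if (πm i j : ℕ) ≤ k then 0 else condP β πm i j)
    (fun j => by split_ifs; exacts [le_rfl, hPn j])
    (fun j hj => by simp [hj])
    (fun j hj => by
      rw [if_neg (by omega), one_mul]; exact condP_le β h1 h2 πm i j)
  have hle : ∀ j, |condK β k πm i j - condP β πm i j| ≤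
      2 * (if (πm i j : ℕ) ≤ k then 0 else condP β πm i j) + (condK β k πm i j - condP β πm i j) := by
    intro j
    split_ifs with hj
    · have := condP_le_condK β h1 h2 πm i hπ k hk j hj
      rw [abs_of_nonneg (by linarith)]; linarith
    · rw [condK_eq_zero β πm i k j (by omega), zero_sub, abs_neg, abs_of_nonneg (hPn j)]; linarith
  have hsum := ((hts.mul_left 2).hasSum.add (hK.sub hP))
  have hS := Summable.of_nonneg_of_le (fun j => abs_nonneg _) hle hsum.summable
  refine ⟨hS, ?_⟩
  refine (hS.tsum_le_tsum hle hsum.summable).trans ?_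
  rw [hsum.tsum_eq, tsum_mul_left]
  have : 2 / (β - 1) * (k : ℝ) ^ (1 - β) = 2 * ((k : ℝ) ^ (1 - β) / (β - 1)) := by ring
  rw [this]
  linarith
end facts

lemma nPair_eq {T : ℕ} (s : Fin T → ℕ+ × ℕ+) (i j : ℕ+) :
    (nPair s i j : ℝ) = ∑ t, Set.indicator {(i, j)} (1 : ℕ+ × ℕ+ → ℝ) (s t) := by
  classical
  simp only [nPair, Set.indicator_apply, Set.mem_singleton_iff, Pi.one_apply, Finset.sum_boole]

lemma nCtx_eq {T : ℕ} (s : Fin T → ℕ+ × ℕ+) (i : ℕ+) :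
    (nCtx s i : ℝ) = ∑ t, Set.indicator {x : ℕ+ × ℕ+ | x.1 = i} (1 : ℕ+ × ℕ+ → ℝ) (s t) := by
  classical
  simp only [nCtx, Set.indicator_apply, Set.mem_setOf_eq, Pi.one_apply, Finset.sum_boole]

lemma nPair_hasSum {T : ℕ} (s : Fin T → ℕ+ × ℕ+) (i : ℕ+) :
    HasSum (fun j => (nPair s i j : ℝ)) (nCtx s i) := by
  simp_rw [nPair_eq, nCtx_eq]
  apply hasSum_sum
  intro t _
  rcases hst : s t with ⟨a, b⟩
  by_cases ha : a = i
  · subst ha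
    convert hasSum_ite_eq b (1 : ℝ) using 2 with j
    · simp [Set.indicator_apply, eq_comm]
    · simp
  · convert hasSum_zero using 2 with j
    · simp [Set.indicator_apply, ha]
    · simp [ha]

lemma qEmp_nonneg {T : ℕ} (s : Fin T → ℕ+ × ℕ+) (i j : ℕ+) : 0 ≤ qEmp s i j := by
  unfold qEmp; split_ifs <;> positivity

lemma qEmp_sum {T : ℕ} (s : Fin T → ℕ+ × ℕ+) (i : ℕ+) :
    Summable (qEmp s i) ∧ ∑' j, qEmp s i j ≤ 1 := by
  by_cases h : 1 ≤ nCtx s i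
  · have h' : (nCtx s i : ℝ) ≠ 0 := by positivity
    have := (nPair_hasSum s i).div_const (nCtx s i : ℝ)
    rw [div_self h'] at this
    have e : qEmp s i = fun j => (nPair s i j : ℝ) / (nCtx s i : ℝ) := by
      funext j; simp [qEmp, h]
    rw [e]; exact ⟨this.summable, this.tsum_eq.le⟩
  · have e : qEmp s i = fun j => 0 := by
      funext j; simp [qEmp, h]
    rw [e]; exact ⟨summable_zero, by simp⟩

lemma mu_fst (p : ℕ+ → ℝ) (hp0 : ∀ i, 0 ≤ p i) (K : ℕ+ → ℕ+ → ℝ) (i : ℕ+) (hK0 : ∀ j, 0 ≤ K i j)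
    (hK : HasSum (K i) 1) (μ : Measure (ℕ+ × ℕ+))
    (hμ : ∀ i j : ℕ+, μ {(i, j)} = ENNReal.ofReal (p i * K i j)) :
    μ.real {x | x.1 = i} = p i := by
  have e : {x : ℕ+ × ℕ+ | x.1 = i} = ⋃ j : ℕ+, {(i, j)} := by
    ext ⟨a, b⟩; simp [eq_comm]
  have hs := hK.mul_left (p i)
  rw [measureReal_def, e, measure_iUnion]
  · simp_rw [hμ]
    rw [← ENNReal.ofReal_tsum_of_nonneg (fun j => mul_nonneg (hp0 i) (hK0 j)) hs.summable, hs.tsum_eq,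
      mul_one, ENNReal.toReal_ofReal (hp0 i)]
  · intro a b hab
    simp [Function.onFun, hab]
  · intro j; exact measurableSet_singleton _

lemma integrable_bdd {Ω : Type*} [MeasurableSpace Ω] [DiscreteMeasurableSpace Ω]
    (ν : Measure Ω) [IsFiniteMeasure ν] (f : Ω → ℝ) (C : ℝ) (h : ∀ x, |f x| ≤ C) :
    Integrable f ν :=
  Integrable.of_bound (Measurable.of_discrete).aestronglyMeasurable C (Filter.Eventually.of_forall h)

lemma sum_abs_le {T : ℕ} (h : ℕ+ × ℕ+ → ℝ) (hb : ∀ x, |h x| ≤ 2) (s : Fin T → ℕ+ × ℕ+) :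
    |∑ t, h (s t)| ≤ T * 2 := by
  refine (Finset.abs_sum_le_sum_abs _ _).trans ?_
  refine (Finset.sum_le_sum (fun t _ => hb (s t))).trans ?_
  simp

lemma second_moment (μ : Measure (ℕ+ × ℕ+)) [IsProbabilityMeasure μ] (T : ℕ) (h : ℕ+ × ℕ+ → ℝ)
    (hb : ∀ x, |h x| ≤ 2) (h0 : ∫ x, h x ∂μ = 0) :
    ∫ s : Fin T → ℕ+ × ℕ+, (∑ t, h (s t)) ^ 2 ∂(Measure.pi fun _ : Fin T => μ) =
      T * ∫ x, h x ^ 2 ∂μ := by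
  have hm : MemLp h 2 μ := MemLp.of_bound (Measurable.of_discrete).aestronglyMeasurable 2
    (Filter.Eventually.of_forall hb)
  have key := ProbabilityTheory.variance_sum_pi (μ := fun _ : Fin T => μ) (X := fun _ => h) (fun _ => hm)
  have hint : ∀ t : Fin T, Integrable (fun s : Fin T → ℕ+ × ℕ+ => h (s t))
      (Measure.pi fun _ : Fin T => μ) := fun t => integrable_bdd _ _ 2 (fun s => hb _)
  rw [ProbabilityTheory.variance_of_integral_eq_zero, ] at key
  · simp only [Finset.sum_apply] at key
    rw [key]
    rw [ProbabilityTheory.variance_of_integral_eq_zero (Measurable.of_discrete).aemeasurable h0]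
    simp
  · exact (Measurable.of_discrete).aemeasurable
  · simp only [Finset.sum_apply]
    rw [integral_finsetSum _ (fun t _ => hint t)]
    apply Finset.sum_eq_zero
    intro t _
    rw [integral_comp_eval (μ := fun _ : Fin T => μ) (f := h)
      (Measurable.of_discrete).aestronglyMeasurable, h0]

lemma first_moment (μ : Measure (ℕ+ × ℕ+)) [IsProbabilityMeasure μ] (T : ℕ) (S : Set (ℕ+ × ℕ+)) :
    ∫ s : Fin T → ℕ+ × ℕ+, (∑ t, S.indicator (1 : ℕ+ × ℕ+ → ℝ) (s t)) ∂(Measure.pi fun _ : Fin T => μ) =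
      T * μ.real S := by
  have hint : ∀ t : Fin T, Integrable (fun s : Fin T → ℕ+ × ℕ+ => S.indicator (1 : ℕ+ × ℕ+ → ℝ) (s t))
      (Measure.pi fun _ : Fin T => μ) := fun t => integrable_bdd _ _ 1 (fun s => by
        by_cases h : s t ∈ S <;> simp [h])
  rw [integral_finsetSum _ (fun t _ => hint t)]
  have : ∀ t : Fin T, ∫ s : Fin T → ℕ+ × ℕ+, S.indicator (1 : ℕ+ × ℕ+ → ℝ) (s t)
      ∂(Measure.pi fun _ : Fin T => μ) = μ.real S := by
    intro t
    rw [integral_comp_eval (μ := fun _ : Fin T => μ) (f := S.indicator (1 : ℕ+ × ℕ+ → ℝ))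
      (Measurable.of_discrete).aestronglyMeasurable, integral_indicator_one (MeasurableSet.of_discrete)]
  simp [this]

section prob
variable (μ : Measure (ℕ+ × ℕ+)) [IsProbabilityMeasure μ] (T : ℕ) (i j : ℕ+) (a κ : ℝ)

lemma ind_abs (S : Set (ℕ+ × ℕ+)) (x : ℕ+ × ℕ+) : |S.indicator (1 : ℕ+ × ℕ+ → ℝ) x| ≤ 1 := by
  by_cases h : x ∈ S <;> simp [h]

lemma ind_int (S : Set (ℕ+ × ℕ+)) : Integrable (S.indicator (1 : ℕ+ × ℕ+ → ℝ)) μ :=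
  integrable_bdd _ _ 1 (ind_abs S)

lemma nPair_le {T : ℕ} (s : Fin T → ℕ+ × ℕ+) (i j : ℕ+) : (nPair s i j : ℝ) ≤ T := by
  have : nPair s i j ≤ T := by
    unfold nPair; exact (Finset.card_le_univ _).trans (by simp)
  exact_mod_cast this

lemma nCtx_le {T : ℕ} (s : Fin T → ℕ+ × ℕ+) (i : ℕ+) : (nCtx s i : ℝ) ≤ T := by
  have : nCtx s i ≤ T := by
    unfold nCtx; exact (Finset.card_le_univ _).trans (by simp)
  exact_mod_cast this

lemma nPair_integrable : Integrable (fun s : Fin T → ℕ+ × ℕ+ => (nPair s i j : ℝ))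
    (Measure.pi fun _ : Fin T => μ) :=
  integrable_bdd _ _ T (fun s => by rw [abs_of_nonneg (by positivity)]; exact nPair_le s i j)

lemma nCtx_integrable : Integrable (fun s : Fin T → ℕ+ × ℕ+ => (nCtx s i : ℝ))
    (Measure.pi fun _ : Fin T => μ) :=
  integrable_bdd _ _ T (fun s => by rw [abs_of_nonneg (by positivity)]; exact nCtx_le s i)

lemma nPair_int (hij : μ.real {(i, j)} = a * κ) :
    ∫ s : Fin T → ℕ+ × ℕ+, (nPair s i j : ℝ) ∂(Measure.pi fun _ : Fin T => μ) = T * (a * κ) := by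
  simp_rw [nPair_eq]; rw [first_moment, hij]

lemma nCtx_int (hi : μ.real {x | x.1 = i} = a) :
    ∫ s : Fin T → ℕ+ × ℕ+, (nCtx s i : ℝ) ∂(Measure.pi fun _ : Fin T => μ) = T * a := by
  simp_rw [nCtx_eq]; rw [first_moment, hi]

lemma Y_abs (hκ0 : 0 ≤ κ) (hκ1 : κ ≤ 1) (s : Fin T → ℕ+ × ℕ+) :
    |(nPair s i j : ℝ) - κ * nCtx s i| ≤ T * 2 := by
  have h1 := nPair_le s i j
  have h2 := nCtx_le s i
  have h3 : κ * nCtx s i ≤ 1 * nCtx s i := by gcongr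
  have h4 : 0 ≤ κ * nCtx s i := by positivity
  have h5 : (0 : ℝ) ≤ nPair s i j := by positivity
  rw [abs_le]; constructor <;> linarith

lemma Y_integrable (hκ0 : 0 ≤ κ) (hκ1 : κ ≤ 1) :
    Integrable (fun s : Fin T → ℕ+ × ℕ+ => |(nPair s i j : ℝ) - κ * nCtx s i|)
    (Measure.pi fun _ : Fin T => μ) :=
  integrable_bdd _ _ (T * 2) (fun s => by rw [abs_abs]; exact Y_abs T i j κ hκ0 hκ1 s)

lemma Y_first (ha : 0 ≤ a) (hκ0 : 0 ≤ κ) (hκ1 : κ ≤ 1) (hij : μ.real {(i, j)} = a * κ)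
    (hi : μ.real {x | x.1 = i} = a) :
    ∫ s : Fin T → ℕ+ × ℕ+, |(nPair s i j : ℝ) - κ * nCtx s i| ∂(Measure.pi fun _ : Fin T => μ)
      ≤ 2 * (T * a) * κ := by
  have h : ∫ s : Fin T → ℕ+ × ℕ+, ((nPair s i j : ℝ) + κ * nCtx s i)
      ∂(Measure.pi fun _ : Fin T => μ) = 2 * (T * a) * κ := by
    rw [integral_add (nPair_integrable μ T i j) ((nCtx_integrable μ T i).const_mul κ),
      integral_const_mul, nPair_int μ T i j a κ hij, nCtx_int μ T i a hi]
    ring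
  rw [← h]
  apply integral_mono (Y_integrable μ T i j κ hκ0 hκ1)
    ((nPair_integrable μ T i j).add ((nCtx_integrable μ T i).const_mul κ))
  intro s
  have h4 : 0 ≤ κ * nCtx s i := by positivity
  have h5 : (0 : ℝ) ≤ nPair s i j := by positivity
  simp only [Pi.add_apply]
  rw [abs_le]; constructor <;> linarith

lemma Y_second (ha : 0 ≤ a) (hκ0 : 0 ≤ κ) (hκ1 : κ ≤ 1) (hij : μ.real {(i, j)} = a * κ)
    (hi : μ.real {x | x.1 = i} = a) :
    ∫ s : Fin T → ℕ+ × ℕ+, ((nPair s i j : ℝ) - κ * nCtx s i) ^ 2 ∂(Measure.pi fun _ : Fin T => μ)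
      ≤ (T * a) * κ := by
  set S : Set (ℕ+ × ℕ+) := {(i, j)}
  set R : Set (ℕ+ × ℕ+) := {x | x.1 = i}
  have hIS := integral_indicator_one (μ := μ) (s := S) MeasurableSet.of_discrete
  have hIR := integral_indicator_one (μ := μ) (s := R) MeasurableSet.of_discrete
  let h : ℕ+ × ℕ+ → ℝ := fun x => S.indicator 1 x - κ * R.indicator 1 x
  have e : ∀ s : Fin T → ℕ+ × ℕ+, (nPair s i j : ℝ) - κ * nCtx s i = ∑ t, h (s t) := by
    intro s
    rw [nPair_eq, nCtx_eq, Finset.mul_sum, ← Finset.sum_sub_distrib]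
  have hb : ∀ x, |h x| ≤ 2 := by
    intro x
    have q1 := abs_le.1 (ind_abs S x)
    have q2 : |κ * R.indicator (1 : ℕ+ × ℕ+ → ℝ) x| ≤ 1 := by
      rw [abs_mul, abs_of_nonneg hκ0]
      exact mul_le_one₀ hκ1 (abs_nonneg _) (ind_abs R x)
    have q3 := abs_le.1 q2
    rw [abs_le]; constructor <;> simp only [h] <;> linarith
  have h0 : ∫ x, h x ∂μ = 0 := by
    simp only [h]
    rw [integral_sub (ind_int μ S) ((ind_int μ R).const_mul κ), integral_const_mul, hIS, hIR, hij, hi]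
    ring
  simp_rw [e]
  rw [second_moment μ T h hb h0]
  have e2 : ∀ x, h x ^ 2 = (1 - 2 * κ) * S.indicator 1 x + κ ^ 2 * R.indicator 1 x := by
    intro x
    by_cases hx : x ∈ S
    · have hx' : x ∈ R := by
        rw [Set.mem_singleton_iff.1 hx]; rfl
      simp [h, hx, hx']; ring
    · by_cases hx' : x ∈ R
      · simp [h, hx, hx']
      · simp [h, hx, hx']
  simp_rw [e2]
  rw [integral_add ((ind_int μ S).const_mul _) ((ind_int μ R).const_mul _), integral_const_mul,
    integral_const_mul, hIS, hIR, hij, hi]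
  have : (T : ℝ) * ((1 - 2 * κ) * (a * κ) + κ ^ 2 * a) = T * a * κ - T * a * κ ^ 2 := by ring
  rw [this]
  have : 0 ≤ T * a * κ ^ 2 := by positivity
  linarith

lemma Y_sqrt (ha : 0 ≤ a) (hκ0 : 0 ≤ κ) (hκ1 : κ ≤ 1) (hij : μ.real {(i, j)} = a * κ)
    (hi : μ.real {x | x.1 = i} = a) (d : ℝ) (hd : 0 < d) (hd2 : T * a * κ ≤ d ^ 2) :
    ∫ s : Fin T → ℕ+ × ℕ+, |(nPair s i j : ℝ) - κ * nCtx s i| ∂(Measure.pi fun _ : Fin T => μ)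
      ≤ d := by
  have h2 := Y_second μ T i j a κ ha hκ0 hκ1 hij hi
  have hI : Integrable (fun s : Fin T → ℕ+ × ℕ+ => ((nPair s i j : ℝ) - κ * nCtx s i) ^ 2)
    (Measure.pi fun _ : Fin T => μ) := integrable_bdd _ _ ((T * 2) ^ 2) (fun s => by
      rw [abs_pow]; gcongr; exact Y_abs T i j κ hκ0 hκ1 s)
  have hm : ∫ s : Fin T → ℕ+ × ℕ+, |(nPair s i j : ℝ) - κ * nCtx s i|
      ∂(Measure.pi fun _ : Fin T => μ) ≤ ∫ s : Fin T → ℕ+ × ℕ+,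
        (d / 2 + 1 / (2 * d) * ((nPair s i j : ℝ) - κ * nCtx s i) ^ 2)
        ∂(Measure.pi fun _ : Fin T => μ) := by
    apply integral_mono (Y_integrable μ T i j κ hκ0 hκ1) ((integrable_const _).add (hI.const_mul _))
    intro s
    simp only [Pi.add_apply]
    generalize (nPair s i j : ℝ) - κ * nCtx s i = y
    have : d / 2 + 1 / (2 * d) * y ^ 2 - |y| = (d - |y|) ^ 2 / (2 * d) := by
      rw [← sq_abs y]; field_simp; ring
    have : 0 ≤ (d - |y|) ^ 2 / (2 * d) := by positivity
    linarith
  rw [integral_add (integrable_const _) (hI.const_mul _), integral_const_mul] at hm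
  simp only [integral_const, probReal_univ, smul_eq_mul, one_mul] at hm
  have : 1 / (2 * d) * ∫ s : Fin T → ℕ+ × ℕ+, ((nPair s i j : ℝ) - κ * nCtx s i) ^ 2
      ∂(Measure.pi fun _ : Fin T => μ) ≤ 1 / (2 * d) * d ^ 2 := by
    gcongr; linarith
  have e : 1 / (2 * d) * d ^ 2 = d / 2 := by field_simp
  linarith

lemma ctx_second (ha0 : 0 ≤ a) (hi : μ.real {x | x.1 = i} = a) :
    ∫ s : Fin T → ℕ+ × ℕ+, ((nCtx s i : ℝ) - T * a) ^ 2 ∂(Measure.pi fun _ : Fin T => μ)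
      ≤ T * a := by
  have ha1 : a ≤ 1 := by rw [← hi]; exact measureReal_le_one
  set R : Set (ℕ+ × ℕ+) := {x | x.1 = i}
  have hIR := integral_indicator_one (μ := μ) (s := R) MeasurableSet.of_discrete
  let h : ℕ+ × ℕ+ → ℝ := fun x => R.indicator 1 x - a
  have e : ∀ s : Fin T → ℕ+ × ℕ+, (nCtx s i : ℝ) - T * a = ∑ t, h (s t) := by
    intro s
    rw [nCtx_eq, Finset.sum_sub_distrib]; simp [R]
  have hb : ∀ x, |h x| ≤ 2 := by
    intro x
    have q1 := abs_le.1 (ind_abs R x)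
    rw [abs_le]; constructor <;> simp only [h] <;> linarith
  have h0 : ∫ x, h x ∂μ = 0 := by
    simp only [h]
    rw [integral_sub (ind_int μ R) (integrable_const _), hIR, hi]
    simp
  simp_rw [e]
  rw [second_moment μ T h hb h0]
  have e2 : ∀ x, h x ^ 2 = (1 - 2 * a) * R.indicator 1 x + a ^ 2 := by
    intro x
    by_cases hx' : x ∈ R
    · simp [h, hx']; ring
    · simp [h, hx']
  simp_rw [e2]
  rw [integral_add ((ind_int μ R).const_mul _) (integrable_const _), integral_const_mul, hIR, hi]
  simp only [integral_const, probReal_univ, smul_eq_mul, one_mul]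
  have : (T : ℝ) * ((1 - 2 * a) * a + a ^ 2) = T * a - T * a ^ 2 := by ring
  rw [this]
  have : 0 ≤ T * a ^ 2 := by positivity
  linarith
end prob

lemma err_le_two {T : ℕ} (s : Fin T → ℕ+ × ℕ+) (i : ℕ+) (P : ℕ+ → ℝ) (hP0 : ∀ j, 0 ≤ P j)
    (hP : HasSum P 1) : Summable (fun j => |qEmp s i j - P j|) ∧
      0 ≤ ∑' j, |qEmp s i j - P j| ∧ ∑' j, |qEmp s i j - P j| ≤ 2 := by
  have hle : ∀ j, |qEmp s i j - P j| ≤ qEmp s i j + P j := by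
    intro j
    have := qEmp_nonneg s i j
    have := hP0 j
    rw [abs_le]; constructor <;> linarith
  obtain ⟨hq, hq1⟩ := qEmp_sum s i
  have hS := Summable.of_nonneg_of_le (fun j => abs_nonneg _) hle (hq.add hP.summable)
  refine ⟨hS, tsum_nonneg fun j => abs_nonneg _, ?_⟩
  refine (hS.tsum_le_tsum hle (hq.add hP.summable)).trans ?_
  rw [hq.tsum_add hP.summable, hP.tsum_eq]; linarith

lemma err_integrable (ν : ∀ T : ℕ, Measure (Fin T → ℕ+ × ℕ+)) (T : ℕ) [IsFiniteMeasure (ν T)] (i : ℕ+) (P : ℕ+ → ℝ)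
    (hP0 : ∀ j, 0 ≤ P j) (hP : HasSum P 1) :
    Integrable (fun s : Fin T → ℕ+ × ℕ+ => ∑' j, |qEmp s i j - P j|) (ν T) :=
  integrable_bdd _ _ 2 (fun s => by
    have := err_le_two s i P hP0 hP
    rw [abs_of_nonneg this.2.1]; exact this.2.2)

lemma err_pointwise {T : ℕ} (s : Fin T → ℕ+ × ℕ+) (i : ℕ+) (P K : ℕ+ → ℝ) (hP0 : ∀ j, 0 ≤ P j)
    (hP : HasSum P 1) (hK : HasSum K 1) (hKP : Summable fun j => |K j - P j|)
    (m : ℝ) (hm : 0 < m) :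
    ∑' j, |qEmp s i j - P j| ≤ ∑' j, |K j - P j| +
      2 / m * ∑' j, |(nPair s i j : ℝ) - K j * nCtx s i| + 8 / m ^ 2 * ((nCtx s i : ℝ) - m) ^ 2 := by
  have hY : Summable fun j => |(nPair s i j : ℝ) - K j * nCtx s i| :=
    ((nPair_hasSum s i).sub (hK.mul_right _)).summable.abs
  have t1 : 0 ≤ ∑' j, |K j - P j| := tsum_nonneg fun j => abs_nonneg _
  have t2 : 0 ≤ 2 / m * ∑' j, |(nPair s i j : ℝ) - K j * nCtx s i| :=
    mul_nonneg (by positivity) (tsum_nonneg fun j => abs_nonneg _)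
  have t3 : 0 ≤ 8 / m ^ 2 * ((nCtx s i : ℝ) - m) ^ 2 := by positivity
  obtain ⟨hS, -, h2⟩ := err_le_two s i P hP0 hP
  rcases le_or_gt (m / 2) (nCtx s i : ℝ) with h | h
  · have hpos : (0 : ℝ) < nCtx s i := by linarith
    have h1 : 1 ≤ nCtx s i := by exact_mod_cast hpos
    have hle : ∀ j, |qEmp s i j - P j| ≤ |K j - P j| +
        2 / m * |(nPair s i j : ℝ) - K j * nCtx s i| := by
      intro j
      have e : qEmp s i j - P j = (K j - P j) + ((nPair s i j : ℝ) - K j * nCtx s i) / nCtx s i := by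
        unfold qEmp; rw [if_pos h1]; field_simp; ring
      rw [e]
      refine (abs_add_le _ _).trans ?_
      rw [abs_div, abs_of_pos hpos, div_eq_inv_mul]
      gcongr
      rw [inv_le_comm₀ hpos (by positivity)]
      simpa using h
    have := hS.tsum_le_tsum hle (hKP.add (hY.mul_left _))
    rw [hKP.tsum_add (hY.mul_left _), tsum_mul_left] at this
    linarith
  · have : 2 ≤ 8 / m ^ 2 * ((nCtx s i : ℝ) - m) ^ 2 := by
      have h3 : (m / 2) ^ 2 ≤ ((nCtx s i : ℝ) - m) ^ 2 := by nlinarith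
      calc (2 : ℝ) = 8 / m ^ 2 * (m / 2) ^ 2 := by field_simp; norm_num
        _ ≤ _ := by gcongr
    linarith

lemma upper_large (β : ℝ) (h1 : 1 < β) (h2 : β < 2) (p : ℕ+ → ℝ) (hp0 : ∀ i, 0 ≤ p i)
    (πm : ℕ+ → ℕ+ → ℕ+) (i : ℕ+) (hπ : Function.Bijective (πm i)) (k : ℕ) (hk : 1 ≤ k)
    (μ : Measure (ℕ+ × ℕ+)) [IsProbabilityMeasure μ]
    (hμ : ∀ i j : ℕ+, μ {(i, j)} = ENNReal.ofReal (p i * condK β k πm i j)) (T : ℕ)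
    (hm : 1 ≤ T * p i) :
    ∫ s : Fin T → ℕ+ × ℕ+, (∑' j : ℕ+, |qEmp s i j - condP β πm i j|)
      ∂(Measure.pi fun _ : Fin T => μ) ≤
      2 / (β - 1) * (k : ℝ) ^ (1 - β) +
        (2 * (2 / (1 - β / 2) + 2 / (β - 1)) + 8) * (T * p i) ^ (1 / β - 1) := by
  have hP0 := condP_nonneg β h1 h2 πm i
  have hP := condP_hasSum β h1 h2 πm i hπ
  have hK0 := condK_nonneg β h1 h2 πm i hπ k hk
  have hK := condK_hasSum β h1 h2 πm i hπ k hk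
  have hKle := condK_le β h1 h2 πm i hπ k hk
  obtain ⟨hKPs, hKPb⟩ := condK_sub_condP β h1 h2 πm i hπ k hk
  have hi := mu_fst p hp0 (condK β k πm) i hK0 hK μ hμ
  have hij : ∀ j, μ.real {(i, j)} = p i * condK β k πm i j := by
    intro j
    rw [measureReal_def, hμ, ENNReal.toReal_ofReal (mul_nonneg (hp0 i) (hK0 j))]
  have hK1 : ∀ j, condK β k πm i j ≤ 1 := by
    intro j
    have := hK.summable.le_tsum j (fun j _ => hK0 j)
    rwa [hK.tsum_eq] at this
  set P := condP β πm i
  set K := condK β k πm i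
  set a := p i
  have ha := hp0 i
  set m : ℝ := T * a with hmdef
  have hm0 : 0 < m := by linarith
  set ν := (Measure.pi fun _ : Fin T => μ)
  -- the cutoff
  set x : ℝ := m ^ (1 / β) with hx
  have hx1 : 1 ≤ x := Real.one_le_rpow hm (by positivity)
  set N : ℕ := ⌈x⌉₊ with hN
  have hxN : x ≤ N := Nat.le_ceil x
  have hNx : (N : ℝ) ≤ 2 * x := by
    have := Nat.ceil_lt_add_one (by linarith : 0 ≤ x)
    linarith
  have hN1 : 1 ≤ N := by
    have : (1 : ℝ) ≤ N := by linarith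
    exact_mod_cast this
  have hsum := aux_pnat β (√m) (2 * m) h1 h2 (by positivity) (by positivity) N hN1 (πm i) hπ
    (fun j => ∫ s : Fin T → ℕ+ × ℕ+, |(nPair s i j : ℝ) - K j * nCtx s i| ∂ν)
    (fun j => integral_nonneg fun s => abs_nonneg _)
    (fun j _ => by
      have hr : (0 : ℝ) < (πm i j : ℕ) := by exact_mod_cast (πm i j).2
      refine Y_sqrt μ T i j a (K j) ha (hK0 j) (hK1 j) (hij j) hi _ (by positivity) ?_
      rw [mul_pow, Real.sq_sqrt hm0.le, ← Real.rpow_natCast, ← Real.rpow_mul hr.le]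
      have : -(β / 2) * ((2 : ℕ) : ℝ) = -β := by push_cast; ring
      rw [this]
      have := hKle j
      gcongr)
    (fun j _ => by
      refine (Y_first μ T i j a (K j) ha (hK0 j) (hK1 j) (hij j) hi).trans ?_
      have := hKle j
      gcongr)
  obtain ⟨hYs, hYb⟩ := hsum
  have hHS := hasSum_integral_of_summable_integral_norm (μ := ν)
    (F := fun (j : ℕ+) (s : Fin T → ℕ+ × ℕ+) => |(nPair s i j : ℝ) - K j * nCtx s i|)
    (fun j => Y_integrable μ T i j (K j) (hK0 j) (hK1 j)) (by simpa using hYs)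
  have hYtot : ∀ s : Fin T → ℕ+ × ℕ+, |(∑' j, |(nPair s i j : ℝ) - K j * nCtx s i| : ℝ)| ≤ T * 2 := by
    intro s
    have hs1 := nPair_hasSum s i
    have hs2 := hK.mul_right (nCtx s i : ℝ)
    rw [abs_of_nonneg (tsum_nonneg fun j => abs_nonneg _)]
    refine ((hs1.sub hs2).summable.abs.tsum_le_tsum (fun j => ?_) (hs1.add hs2).summable).trans ?_
    · have h4 : 0 ≤ K j * nCtx s i := mul_nonneg (hK0 j) (by positivity)
      have h5 : (0 : ℝ) ≤ nPair s i j := by positivity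
      rw [abs_le]; constructor <;> linarith
    · rw [(hs1.add hs2).tsum_eq]; linarith [nCtx_le s i]
  have hI1 : Integrable (fun s : Fin T → ℕ+ × ℕ+ => ∑' j, |(nPair s i j : ℝ) - K j * nCtx s i|) ν :=
    integrable_bdd _ _ _ hYtot
  have hI2 : Integrable (fun s : Fin T → ℕ+ × ℕ+ => ((nCtx s i : ℝ) - m) ^ 2) ν :=
    integrable_bdd _ _ ((T + m) ^ 2) (fun s => by
      rw [abs_pow]
      have : |(nCtx s i : ℝ) - m| ≤ T + m := by
        have := nCtx_le s i
        have : (0 : ℝ) ≤ nCtx s i := by positivity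
        rw [abs_le]; constructor <;> linarith
      gcongr)
  have hI12 := ((integrable_const (μ := ν) (∑' j, |K j - P j|)).add (hI1.const_mul (2 / m))).add
      (hI2.const_mul (8 / m ^ 2))
  have hmain := integral_mono (err_integrable (fun T => (Measure.pi fun _ : Fin T => μ)) T i P hP0 hP)
    hI12 (fun s => err_pointwise s i P K hP0 hP hK hKPs m hm0)
  refine hmain.trans ?_
  rw [integral_add' ((integrable_const _).add (hI1.const_mul _)) (hI2.const_mul _),
    integral_add' (integrable_const _) (hI1.const_mul _), integral_const_mul, integral_const_mul]
  simp only [integral_const, probReal_univ, smul_eq_mul, one_mul]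
  rw [← hHS.tsum_eq]
  have hc2 := ctx_second μ T i a ha hi
  have hb0 : 0 < β - 1 := by linarith
  have hs0 : 0 < 1 - β / 2 := by linarith
  have hβ0 : 0 < β := by linarith
  -- numeric bounds
  have hY2 : √m * ((N : ℝ) ^ (1 - β / 2) / (1 - β / 2)) + 2 * m * ((N : ℝ) ^ (1 - β) / (β - 1)) ≤
      (2 / (1 - β / 2) + 2 / (β - 1)) * x := by
    have b1 : (N : ℝ) ^ (1 - β / 2) ≤ 2 * m ^ (1 / β - 1 / 2) := by
      calc (N : ℝ) ^ (1 - β / 2) ≤ (2 * x) ^ (1 - β / 2) := by gcongr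
        _ = 2 ^ (1 - β / 2) * x ^ (1 - β / 2) := Real.mul_rpow (by norm_num) (by linarith)
        _ ≤ 2 ^ (1 : ℝ) * m ^ (1 / β - 1 / 2) := by
          have : x ^ (1 - β / 2) = m ^ (1 / β - 1 / 2) := by
            rw [hx, ← Real.rpow_mul hm0.le]; congr 1; field_simp
          rw [this]
          gcongr
          · norm_num
          · linarith
        _ = _ := by simp
    have b2 : (N : ℝ) ^ (1 - β) ≤ m ^ (1 / β - 1) := by
      calc (N : ℝ) ^ (1 - β) ≤ x ^ (1 - β) :=
            Real.rpow_le_rpow_of_nonpos (by linarith) hxN (by linarith)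
        _ = _ := by rw [hx, ← Real.rpow_mul hm0.le]; congr 1; field_simp
    have b3 : √m * m ^ (1 / β - 1 / 2) = x := by
      rw [Real.sqrt_eq_rpow, ← Real.rpow_add hm0, hx]; congr 1; ring
    have b4 : m * m ^ (1 / β - 1) = x := by
      rw [Real.rpow_sub_one hm0.ne', hx]; field_simp
    calc _ ≤ √m * (2 * m ^ (1 / β - 1 / 2) / (1 - β / 2)) + 2 * m * (m ^ (1 / β - 1) / (β - 1)) := by
          gcongr
      _ = 2 / (1 - β / 2) * (√m * m ^ (1 / β - 1 / 2)) + 2 / (β - 1) * (m * m ^ (1 / β - 1)) := by ring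
      _ = _ := by rw [b3, b4]; ring
  have e1 : m ^ (1 / β - 1) = x / m := by rw [Real.rpow_sub_one hm0.ne', hx]
  have f1 : 2 / m * ∑' j, ∫ s : Fin T → ℕ+ × ℕ+, |(nPair s i j : ℝ) - K j * nCtx s i| ∂ν ≤
      2 / m * ((2 / (1 - β / 2) + 2 / (β - 1)) * x) := by
    have := hYb.trans hY2
    gcongr
  have f2 : 8 / m ^ 2 * ∫ s : Fin T → ℕ+ × ℕ+, ((nCtx s i : ℝ) - m) ^ 2 ∂ν ≤ 8 * (x / m) := by
    calc 8 / m ^ 2 * ∫ s : Fin T → ℕ+ × ℕ+, ((nCtx s i : ℝ) - m) ^ 2 ∂ν ≤ 8 / m ^ 2 * m := by gcongr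
      _ = 8 * (1 / m) := by field_simp
      _ ≤ _ := by gcongr
  have f3 : (2 * (2 / (1 - β / 2) + 2 / (β - 1)) + 8) * (x / m) =
    2 / m * ((2 / (1 - β / 2) + 2 / (β - 1)) * x) + 8 * (x / m) := by ring
  rw [e1, f3]
  linarith

lemma lower_i (β : ℝ) (h1 : 1 < β) (h2 : β < 2) (p : ℕ+ → ℝ) (hp0 : ∀ i, 0 ≤ p i)
    (πm : ℕ+ → ℕ+ → ℕ+) (i : ℕ+) (hπ : Function.Bijective (πm i)) (k : ℕ) (hk : 1 ≤ k)
    (μ : Measure (ℕ+ × ℕ+)) [IsProbabilityMeasure μ]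
    (hμ : ∀ i j : ℕ+, μ {(i, j)} = ENNReal.ofReal (p i * condK β k πm i j)) (T : ℕ)
    (n : ℕ+) (hn : ∀ j, (n : ℕ) ≤ (πm i j : ℕ) → T * (p i * condK β k πm i j) ≤ 1 / 2) :
    1 / 2 * (2 ^ (-β) / ∑' m : ℕ+, ((m : ℕ) : ℝ) ^ (-β)) * ((n : ℕ) : ℝ) ^ (1 - β) ≤
    ∫ s : Fin T → ℕ+ × ℕ+, (∑' j : ℕ+, |qEmp s i j - condP β πm i j|)
      ∂(Measure.pi fun _ : Fin T => μ) := by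
  have hP0 := condP_nonneg β h1 h2 πm i
  have hP := condP_hasSum β h1 h2 πm i hπ
  have hK0 := condK_nonneg β h1 h2 πm i hπ k hk
  have hij : ∀ j, μ.real {(i, j)} = p i * condK β k πm i j := by
    intro j
    rw [measureReal_def, hμ, ENNReal.toReal_ofReal (mul_nonneg (hp0 i) (hK0 j))]
  have hz := zeta_ge_one_s13 β h1 h2
  let E := Equiv.ofBijective (πm i) hπ
  let F : Finset ℕ+ := (Finset.Icc n (2 * n)).map E.symm.toEmbedding
  have hF : ∀ j ∈ F, (n : ℕ) ≤ (πm i j : ℕ) ∧ (πm i j : ℕ) ≤ 2 * (n : ℕ) := by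
    intro j hj
    obtain ⟨r, hr, rfl⟩ := Finset.mem_map.1 hj
    have e : πm i (E.symm r) = r := E.apply_symm_apply r
    have hr' := Finset.mem_Icc.1 hr
    simp only [Equiv.coe_toEmbedding, e]
    exact ⟨hr'.1, by have := hr'.2; exact_mod_cast this⟩
  have hcard : F.card = (n : ℕ) + 1 := by
    simp only [F, Finset.card_map, PNat.card_Icc, PNat.mul_coe]
    have : ((2 : ℕ+) : ℕ) = 2 := rfl
    rw [this]; omega
  have hn0 : (0 : ℝ) < (n : ℕ) := by exact_mod_cast n.2
  set Z := ∑' m : ℕ+, ((m : ℕ) : ℝ) ^ (-β) with hZ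
  have hPF : ∀ j ∈ F, (2 * ((n : ℕ) : ℝ)) ^ (-β) / Z ≤ condP β πm i j := by
    intro j hj
    unfold condP
    have hr : (0 : ℝ) < (πm i j : ℕ) := by exact_mod_cast (πm i j).2
    rw [← hZ]
    have : (2 * ((n : ℕ) : ℝ)) ^ (-β) ≤ ((πm i j : ℕ) : ℝ) ^ (-β) :=
      Real.rpow_le_rpow_of_nonpos hr (by exact_mod_cast (hF j hj).2) (by linarith)
    gcongr
  have hmono : ∫ s : Fin T → ℕ+ × ℕ+, (∑ j ∈ F, condP β πm i j * (1 - (nPair s i j : ℝ)))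
      ∂(Measure.pi fun _ : Fin T => μ) ≤ ∫ s : Fin T → ℕ+ × ℕ+, (∑' j : ℕ+, |qEmp s i j - condP β πm i j|)
      ∂(Measure.pi fun _ : Fin T => μ) := by
    apply integral_mono
    · exact integrable_finsetSum _ fun j _ =>
        ((integrable_const _).sub (nPair_integrable μ T i j)).const_mul _
    · exact err_integrable (fun T => (Measure.pi fun _ : Fin T => μ)) T i _ hP0 hP
    · intro s
      refine le_trans ?_ ((err_le_two s i _ hP0 hP).1.sum_le_tsum F (fun j _ => abs_nonneg _))
      apply Finset.sum_le_sum
      intro j _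
      rcases Nat.eq_zero_or_pos (nPair s i j) with h | h
      · have : qEmp s i j = 0 := by unfold qEmp; rw [h]; simp
        rw [h, this, zero_sub, abs_neg, abs_of_nonneg (hP0 j)]; simp
      · refine le_trans ?_ (abs_nonneg _)
        apply mul_nonpos_of_nonneg_of_nonpos (hP0 j)
        have : (1 : ℝ) ≤ nPair s i j := by exact_mod_cast h
        linarith
  refine le_trans ?_ hmono
  have hintF : ∀ j ∈ F, Integrable (fun s : Fin T → ℕ+ × ℕ+ =>
      condP β πm i j * (1 - (nPair s i j : ℝ))) (Measure.pi fun _ : Fin T => μ) := fun j _ =>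
        ((integrable_const (1 : ℝ)).sub (nPair_integrable μ T i j)).const_mul _
  rw [integral_finsetSum _ hintF]
  have hterm : ∀ j ∈ F, 1 / 2 * ((2 * ((n : ℕ) : ℝ)) ^ (-β) / Z) ≤
      ∫ s : Fin T → ℕ+ × ℕ+, condP β πm i j * (1 - (nPair s i j : ℝ))
        ∂(Measure.pi fun _ : Fin T => μ) := by
    intro j hj
    rw [integral_const_mul, integral_sub (integrable_const _) (nPair_integrable μ T i j),
      nPair_int μ T i j (p i) (condK β k πm i j) (hij j)]
    simp only [integral_const, probReal_univ, smul_eq_mul, one_mul]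
    have q1 := hn j (hF j hj).1
    have q2 := hPF j hj
    have q3 := hP0 j
    nlinarith
  refine le_trans ?_ (Finset.card_nsmul_le_sum F _ _ hterm)
  rw [hcard, nsmul_eq_mul, Real.mul_rpow (by norm_num) hn0.le]
  have e : ((n : ℕ) : ℝ) ^ (1 - β) = (n : ℕ) * ((n : ℕ) : ℝ) ^ (-β) := by
    rw [← Real.rpow_one_add' hn0.le (by linarith)]; congr 1
  rw [e]
  have : 1 / 2 * (2 ^ (-β) / Z) * (((n : ℕ) : ℝ) * ((n : ℕ) : ℝ) ^ (-β)) =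
    ((n : ℕ) : ℝ) * (1 / 2 * (2 ^ (-β) * ((n : ℕ) : ℝ) ^ (-β) / Z)) := by ring
  rw [this]
  gcongr
  linarith


/-- Two-sided model-collapse scaling law for Hutter++: for
`β ∈ (1,2)`, `c = 1 - 1/β`, `∑_i p_i^(1-c) < ∞`, permutations `π_i`, and training
data whose conditionals are tail-chopped at rank `k`, the test error against the true
conditionals satisfies `C₁ (T^(-c) + k^(-βc)) ≤ E_test(T) ≤ C₂ (T^(-c) + k^(-βc))`
for all `T ≥ T₀` and all sufficiently large `k`, with constants depending only on `β`
and `p`: an irreducible plateau of order `k^(-βc)`. -/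
theorem hutterpp_collapse_two_sided (β : ℝ) (hβ1 : 1 < β) (hβ2 : β < 2)
    (c : ℝ) (hc : c = 1 - 1 / β)
    (p : ℕ+ → ℝ) (hp0 : ∀ i, 0 ≤ p i) (hp1 : (∑' i : ℕ+, p i) = 1)
    (hps : Summable fun i : ℕ+ => p i ^ (1 - c)) :
    ∃ C₁ C₂ : ℝ, 0 < C₁ ∧ 0 < C₂ ∧ ∃ T₀ k₀ : ℕ,
      ∀ πm : ℕ+ → ℕ+ → ℕ+, (∀ i, Function.Bijective (πm i)) →
      ∀ k : ℕ, k₀ ≤ k →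
      ∀ μ : Measure (ℕ+ × ℕ+), IsProbabilityMeasure μ →
        (∀ i j : ℕ+, μ {(i, j)} = ENNReal.ofReal (p i * condK β k πm i j)) →
      ∀ T : ℕ, T₀ ≤ T →
        C₁ * ((T : ℝ) ^ (-c) + (k : ℝ) ^ (-(β * c))) ≤ EtestBigram p (condP β πm) μ T ∧
        EtestBigram p (condP β πm) μ T ≤
          C₂ * ((T : ℝ) ^ (-c) + (k : ℝ) ^ (-(β * c))) := by
  have hb0 : 0 < β - 1 := by linarith
  have hs0 : 0 < 1 - β / 2 := by linarith
  have hβ0 : 0 < β := by linarith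
  have hc' : -c = 1 / β - 1 := by rw [hc]; ring
  have hc0 : 0 < c := by
    have : 1 / β < 1 := by rw [div_lt_one hβ0]; exact hβ1
    linarith
  have hc1 : c < 1 := by
    have : 0 < 1 / β := by positivity
    linarith
  have hbc : -(β * c) = 1 - β := by rw [hc]; field_simp; ring
  have hz := zeta_ge_one_s13 β hβ1 hβ2
  set Z := ∑' m : ℕ+, ((m : ℕ) : ℝ) ^ (-β) with hZ
  have hpsum : Summable p := by
    by_contra h
    rw [tsum_eq_zero_of_not_summable h] at hp1
    exact zero_ne_one hp1
  obtain ⟨i₀, hi₀⟩ : ∃ i, 0 < p i := by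
    by_contra! h
    have : p = fun _ => 0 := by funext i; exact le_antisymm (h i) (hp0 i)
    rw [this] at hp1; simp at hp1
  set D : ℝ := 2 / (β - 1) with hD
  have hD0 : 0 < D := by positivity
  set C : ℝ := 2 * (2 / (1 - β / 2) + 2 / (β - 1)) + 8 with hC
  have hC2 : 2 ≤ C := by
    have : 0 < 2 * (2 / (1 - β / 2) + 2 / (β - 1)) := by positivity
    linarith
  set S : ℝ := ∑' i, p i ^ (1 - c) with hS
  have hS0 : 0 ≤ S := tsum_nonneg fun i => Real.rpow_nonneg (hp0 i) _
  set L : ℝ := 1 / 2 * (2 ^ (-β) / Z) with hL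
  have hL0 : 0 < L := by positivity
  refine ⟨p i₀ * (L * 4 ^ (1 - β)) / 2, D + C * S, by positivity, by positivity, 1, 1, ?_⟩
  intro πm hπ k hk μ hμp hμ T hT
  rw [hbc]
  have hT0 : (0 : ℝ) < T := by exact_mod_cast hT
  have hk0 : (0 : ℝ) < k := by exact_mod_cast hk
  have hP0 := fun i => condP_nonneg β hβ1 hβ2 πm i
  have hP := fun i => condP_hasSum β hβ1 hβ2 πm i (hπ i)
  set I : ℕ+ → ℝ := fun i => ∫ s : Fin T → ℕ+ × ℕ+, (∑' j : ℕ+, |qEmp s i j - condP β πm i j|)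
      ∂(Measure.pi fun _ : Fin T => μ) with hI
  have hI0 : ∀ i, 0 ≤ I i := fun i => integral_nonneg fun s => tsum_nonneg fun j => abs_nonneg _
  have hI2 : ∀ i, I i ≤ 2 := by
    intro i
    have := integral_mono (err_integrable (fun T => (Measure.pi fun _ : Fin T => μ)) T i _ (hP0 i) (hP i))
      (integrable_const (2 : ℝ)) (fun s => (err_le_two s i _ (hP0 i) (hP i)).2.2)
    simpa using this
  have hEt : EtestBigram p (condP β πm) μ T = ∑' i, p i * I i := rfl
  have hIs : Summable fun i => p i * I i :=
    Summable.of_nonneg_of_le (fun i => mul_nonneg (hp0 i) (hI0 i))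
      (fun i => mul_le_mul_of_nonneg_left (hI2 i) (hp0 i)) (hpsum.mul_right 2)
  rw [hEt]
  constructor
  · have hle : p i₀ * I i₀ ≤ ∑' i, p i * I i :=
      hIs.le_tsum i₀ (fun i _ => mul_nonneg (hp0 i) (hI0 i))
    have hp1' : p i₀ ≤ 1 := by
      rw [← hp1]; exact hpsum.le_tsum i₀ (fun i _ => hp0 i)
    have hK0 := condK_nonneg β hβ1 hβ2 πm i₀ (hπ i₀) k hk
    have hKle := condK_le β hβ1 hβ2 πm i₀ (hπ i₀) k hk
    -- plateau
    have hA : L * 4 ^ (1 - β) * (k : ℝ) ^ (1 - β) ≤ I i₀ := by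
      have := lower_i β hβ1 hβ2 p hp0 πm i₀ (hπ i₀) k hk μ hμ T ⟨k + 1, by omega⟩ (by
        intro j hj
        rw [condK_eq_zero β πm i₀ k j (by simpa using hj)]; norm_num)
      refine le_trans ?_ this
      rw [← hZ, ← hL, mul_assoc, ← Real.mul_rpow (by norm_num) hk0.le]
      refine mul_le_mul_of_nonneg_left ?_ hL0.le
      apply Real.rpow_le_rpow_of_nonpos _ _ (by linarith)
      · simp; positivity
      · have : (1 : ℝ) ≤ k := by exact_mod_cast hk
        simp; linarith
    have hB : L * 4 ^ (1 - β) * (T : ℝ) ^ (-c) ≤ I i₀ := by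
      set x : ℝ := (2 * T) ^ (1 / β) with hx
      have hT1 : (1 : ℝ) ≤ T := by exact_mod_cast hT
      have hx1 : 1 ≤ x := Real.one_le_rpow (by linarith) (by positivity)
      have hx4 : x ≤ 2 * (T : ℝ) ^ (1 / β) := by
        rw [hx, Real.mul_rpow (by norm_num) hT0.le]
        gcongr
        calc (2 : ℝ) ^ (1 / β) ≤ 2 ^ (1 : ℝ) := by
              apply Real.rpow_le_rpow_of_exponent_le (by norm_num)
              rw [div_le_one hβ0]; exact hβ1.le
          _ = 2 := by simp
      have hxN : x ≤ (⌈x⌉₊ : ℝ) := Nat.le_ceil x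
      have hNx := Nat.ceil_lt_add_one (by linarith : 0 ≤ x)
      have hpos : 0 < ⌈x⌉₊ := Nat.ceil_pos.2 (by linarith)
      have := lower_i β hβ1 hβ2 p hp0 πm i₀ (hπ i₀) k hk μ hμ T ⟨⌈x⌉₊, hpos⟩ (by
        intro j hj
        have hr : x ≤ ((πm i₀ j : ℕ) : ℝ) := hxN.trans (by exact_mod_cast hj)
        have q1 : ((πm i₀ j : ℕ) : ℝ) ^ (-β) ≤ x ^ (-β) :=
          Real.rpow_le_rpow_of_nonpos (by linarith) hr (by linarith)
        have q2 : x ^ (-β) = 1 / (2 * T) := by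
          rw [hx, ← Real.rpow_mul (by positivity)]
          have : 1 / β * -β = -1 := by field_simp
          rw [this, Real.rpow_neg_one, one_div]
        have q3 : p i₀ * condK β k πm i₀ j ≤ 1 / (2 * T) := by
          calc p i₀ * condK β k πm i₀ j ≤ 1 * condK β k πm i₀ j :=
                mul_le_mul_of_nonneg_right hp1' (hK0 j)
            _ ≤ 1 / (2 * T) := by rw [one_mul, ← q2]; exact (hKle j).trans q1
        calc (T : ℝ) * (p i₀ * condK β k πm i₀ j) ≤ T * (1 / (2 * T)) := by gcongr
          _ = 1 / 2 := by field_simp)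
      refine le_trans ?_ this
      have e : (T : ℝ) ^ (-c) = ((T : ℝ) ^ (1 / β)) ^ (1 - β) := by
        rw [← Real.rpow_mul hT0.le, hc']; congr 1; field_simp
      rw [← hZ, ← hL, mul_assoc, e, ← Real.mul_rpow (by norm_num) (by positivity)]
      refine mul_le_mul_of_nonneg_left ?_ hL0.le
      apply Real.rpow_le_rpow_of_nonpos _ _ (by linarith)
      · simpa using hpos
      · simp only [PNat.mk_coe]; linarith
    refine le_trans ?_ hle
    have : p i₀ * (L * 4 ^ (1 - β)) / 2 * ((T : ℝ) ^ (-c) + (k : ℝ) ^ (1 - β)) =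
      p i₀ * ((L * 4 ^ (1 - β) * (T : ℝ) ^ (-c) + L * 4 ^ (1 - β) * (k : ℝ) ^ (1 - β)) / 2) := by ring
    rw [this]
    gcongr
    linarith
  · have hle : ∀ i, p i * I i ≤ D * (k : ℝ) ^ (1 - β) * p i + C * (T : ℝ) ^ (-c) * p i ^ (1 - c) := by
      intro i
      rcases (hp0 i).eq_or_lt with h0 | hpos
      · rw [← h0, Real.zero_rpow (by linarith)]; simp
      have hm0 : 0 < T * p i := by positivity
      have hb : I i ≤ D * (k : ℝ) ^ (1 - β) + C * (T * p i) ^ (-c) := by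
        rcases le_or_gt 1 (T * p i) with h | h
        · have := upper_large β hβ1 hβ2 p hp0 πm i (hπ i) k hk μ hμ T h
          rw [hc']; exact this
        · have q1 : 1 ≤ (T * p i) ^ (-c) :=
            Real.one_le_rpow_of_pos_of_le_one_of_nonpos hm0 h.le (by linarith)
          have q2 : 0 ≤ D * (k : ℝ) ^ (1 - β) := by positivity
          have := hI2 i
          nlinarith
      have e1 : p i ^ (1 - c) = p i * p i ^ (-c) := by
        rw [sub_eq_add_neg, Real.rpow_add hpos, Real.rpow_one]
      calc p i * I i ≤ p i * (D * (k : ℝ) ^ (1 - β) + C * (T * p i) ^ (-c)) := by gcongr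
        _ = _ := by rw [Real.mul_rpow hT0.le hpos.le, e1]; ring
    have hs := (hpsum.mul_left (D * (k : ℝ) ^ (1 - β))).add (hps.mul_left (C * (T : ℝ) ^ (-c)))
    refine (hIs.tsum_le_tsum hle hs).trans ?_
    rw [(hpsum.mul_left _).tsum_add (hps.mul_left _), tsum_mul_left, tsum_mul_left, hp1, ← hS]
    have q1 : 0 ≤ (T : ℝ) ^ (-c) := by positivity
    have q2 : 0 ≤ (k : ℝ) ^ (1 - β) := by positivity
    have : (D + C * S) * ((T : ℝ) ^ (-c) + (k : ℝ) ^ (1 - β)) =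
      D * (k : ℝ) ^ (1 - β) * 1 + C * (T : ℝ) ^ (-c) * S + (D * (T : ℝ) ^ (-c) + C * S * (k : ℝ) ^ (1 - β)) := by
      ring
    rw [this]
    have : 0 ≤ D * (T : ℝ) ^ (-c) + C * S * (k : ℝ) ^ (1 - β) := by positivity
    linarith
end
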